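/- arXiv:1211.2520 — 2 statements merged into one kernel-verified Lean document; each statement's English description precedes it below -/
import Mathlib

section
/- Let U ⊂ ℝ^{n+1}_+ = {(x,y) : x ∈ ℝⁿ, y > 0} be a bounded domain with C¹ boundary such that ∂U ∩ {y = 0} is nonempty, let α ∈ (0,1), and let p > (n+1)/(1−α); set β = 1 − α − (n+1)/p. Then there exists a constant C > 0 such that for every u ∈ C¹(closure U), ‖u‖_{C^β(closure U)} ≤ C·( ∫_U y^{pα}|Du|^p dxdy + ∫_U y^{pα}|u|^p dxdy )^{1/p}. -/
open MeasureTheory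

lemma aux_haar (n : ℕ) : (volume : Measure ((Fin n → ℝ) × ℝ)).IsAddHaarMeasure := by
  rw [Measure.volume_eq_prod]; infer_instance

section generic
set_option linter.unusedSectionVars false
variable {E : Type*} [NormedAddCommGroup E] [NormedSpace ℝ E] [FiniteDimensional ℝ E]
  [MeasurableSpace E] [BorelSpace E] (μ : Measure E) [μ.IsAddHaarMeasure]

lemma aux_holder {Q : Set E} (hQ : IsCompact Q) {f : E → ℝ} (hf : ContinuousOn f Q)
    (hf0 : ∀ x ∈ Q, 0 ≤ f x) {p : ℝ} (hp : 1 < p) :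
    ∫ x in Q, f x ∂μ ≤ μ.real Q ^ (1 - 1 / p) * (∫ x in Q, f x ^ p ∂μ) ^ (1 / p) := by
  have hpq : p.HolderConjugate (p / (p - 1)) := Real.HolderConjugate.conjExponent hp
  have hfin : IsFiniteMeasure (μ.restrict Q) := ⟨by
    rw [Measure.restrict_apply_univ]; exact hQ.measure_lt_top⟩
  have hm : AEStronglyMeasurable f (μ.restrict Q) :=
    (hf.integrableOn_compact hQ).aestronglyMeasurable
  obtain ⟨B, hB⟩ := hQ.exists_bound_of_continuousOn hf
  have hae : ∀ᵐ x ∂(μ.restrict Q), x ∈ Q := ae_restrict_mem hQ.measurableSet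
  have h := integral_mul_le_Lp_mul_Lq_of_nonneg (μ := μ.restrict Q) hpq (f := f) (g := fun _ => 1)
    (by filter_upwards [hae] with x hx using hf0 x hx) (by filter_upwards with x; simp)
    (MemLp.of_bound hm B (by filter_upwards [hae] with x hx using hB x hx))
    (memLp_const 1)
  have h2 : 1 / (p / (p - 1)) = 1 - 1 / p := by
    have : p ≠ 0 := by positivity
    have : p - 1 ≠ 0 := by linarith
    field_simp
  simp only [mul_one, Real.one_rpow, h2] at h
  rw [mul_comm]
  simpa using h

lemma aux_scale {Q : Set E} (hQ : IsCompact Q) (hQc : Convex ℝ Q) {F : E → ℝ}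
    (hF : ContinuousOn F Q) (hF0 : ∀ x ∈ Q, 0 ≤ F x) {a : E} (ha : a ∈ Q) {s : ℝ}
    (hs : s ∈ Set.Ioo (0:ℝ) 1) :
    ∫ w in Q, F (a + s • (w - a)) ∂μ ≤
      (s ^ Module.finrank ℝ E)⁻¹ * ∫ w in Q, F w ∂μ := by
  set G := Q.indicator F with hG
  have hGi : Integrable G μ := (integrable_indicator_iff hQ.measurableSet).2
    (hF.integrableOn_compact hQ)
  have hG0 : ∀ x, 0 ≤ G x := fun x => Set.indicator_nonneg hF0 x
  have hGi2 : Integrable (fun w => G (a + s • (w - a))) μ := by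
    have h1 : Integrable (fun w => G (a + w)) μ := hGi.comp_add_left a
    have h2 : Integrable (fun w => G (a + s • w)) μ := h1.comp_smul hs.1.ne'
    exact h2.comp_sub_right a
  have hmem : ∀ w ∈ Q, a + s • (w - a) ∈ Q := fun w hw =>
    hQc.add_smul_sub_mem ha hw ⟨hs.1.le, hs.2.le⟩
  calc ∫ w in Q, F (a + s • (w - a)) ∂μ = ∫ w in Q, G (a + s • (w - a)) ∂μ := by
        refine setIntegral_congr_fun hQ.measurableSet fun w hw => ?_
        simp only [hG]; rw [Set.indicator_of_mem (hmem w hw)]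
    _ ≤ ∫ w, G (a + s • (w - a)) ∂μ :=
        setIntegral_le_integral hGi2 (Filter.Eventually.of_forall fun w => hG0 _)
    _ = ∫ w, G (a + s • w) ∂μ := integral_sub_right_eq_self (fun w => G (a + s • w)) a
    _ = |(s ^ Module.finrank ℝ E)⁻¹| • ∫ w, G (a + w) ∂μ :=
        Measure.integral_comp_smul μ (fun w => G (a + w)) s
    _ = (s ^ Module.finrank ℝ E)⁻¹ * ∫ w in Q, F w ∂μ := by
        rw [integral_add_left_eq_self, hG, integral_indicator hQ.measurableSet, abs_of_nonneg,
          smul_eq_mul]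
        have := hs.1
        positivity

lemma aux_morrey {V : Set E} (hV : IsOpen V) {u : E → ℝ} (hu : ContDiffOn ℝ 1 u V)
    {z : E} {r : ℝ} (hr : 0 < r) (hQV : Metric.closedBall z r ⊆ V) {p : ℝ} (hp1 : 1 < p)
    (hp : (Module.finrank ℝ E : ℝ) < p) {a : E} (ha : a ∈ Metric.closedBall z r) :
    |(∫ w in Metric.closedBall z r, u w ∂μ) - μ.real (Metric.closedBall z r) * u a| ≤
      2 * r / (1 - Module.finrank ℝ E / p) * (μ.real (Metric.closedBall z r) ^ (1 - 1 / p) *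
        (∫ w in Metric.closedBall z r, ‖fderiv ℝ u w‖ ^ p ∂μ) ^ (1 / p)) := by
  have hp0 : 0 < p := by linarith
  set Q := Metric.closedBall z r with hQdef
  have hQ : IsCompact Q := isCompact_closedBall z r
  have hQc : Convex ℝ Q := convex_closedBall z r
  set d := Module.finrank ℝ E
  set γ : ℝ := d / p with hγ
  have hγ1 : γ < 1 := by rw [hγ, div_lt_one hp0]; exact hp
  set J := ∫ w in Q, ‖fderiv ℝ u w‖ ^ p ∂μ with hJ
  have hJ0 : 0 ≤ J := integral_nonneg fun w => by positivity
  have huc : ContinuousOn u Q := hu.continuousOn.mono hQV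
  have hdc : ContinuousOn (fderiv ℝ u) Q :=
    (hu.continuousOn_fderiv_of_isOpen hV le_rfl).mono hQV
  have hmem : ∀ s ∈ Set.Icc (0:ℝ) 1, ∀ w ∈ Q, a + s • (w - a) ∈ Q := fun s hs w hw =>
    hQc.add_smul_sub_mem ha hw hs
  have hline : ∀ s : ℝ, Continuous fun w : E => a + s • (w - a) := fun s => by fun_prop
  have hucs : ∀ s ∈ Set.Icc (0:ℝ) 1, ContinuousOn (fun w => u (a + s • (w - a))) Q :=
    fun s hs => huc.comp (hline s).continuousOn (hmem s hs)
  have hdcs : ∀ s ∈ Set.Icc (0:ℝ) 1, ContinuousOn (fun w => fderiv ℝ u (a + s • (w - a))) Q :=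
    fun s hs => hdc.comp (hline s).continuousOn (hmem s hs)
  have hnorm : ∀ w ∈ Q, ‖w - a‖ ≤ 2 * r := fun w hw => by
    rw [← dist_eq_norm]
    have h1 : dist w z ≤ r := hw
    have h2 : dist a z ≤ r := ha
    linarith [dist_triangle_right w a z]
  obtain ⟨B, hB⟩ := hQ.exists_bound_of_continuousOn huc
  obtain ⟨B', hB'⟩ := hQ.exists_bound_of_continuousOn hdc
  have hae : ∀ᵐ x ∂(μ.restrict Q), x ∈ Q := ae_restrict_mem hQ.measurableSet
  have hfin : IsFiniteMeasure (μ.restrict Q) := ⟨by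
    rw [Measure.restrict_apply_univ]; exact hQ.measure_lt_top⟩
  set g : ℝ → ℝ := fun s => ∫ w in Q, u (a + s • (w - a)) ∂μ with hg
  have hgc : ContinuousOn g (Set.Icc 0 1) := by
    refine continuousOn_of_dominated (bound := fun _ => B) ?_ ?_ (integrable_const _) ?_
    · intro s hs
      exact ((hucs s hs).integrableOn_compact hQ).aestronglyMeasurable
    · intro s hs
      filter_upwards [hae] with w hw using hB _ (hmem s hs w hw)
    · filter_upwards [hae] with w hw
      exact huc.comp (by fun_prop) fun s hs => hmem s hs w hw
  have hgd : ∀ s ∈ Set.Ioo (0:ℝ) 1,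
      HasDerivAt g (∫ w in Q, fderiv ℝ u (a + s • (w - a)) (w - a) ∂μ) s := by
    intro s hs
    have hnh : Set.Ioo (0:ℝ) 1 ∈ nhds s := Ioo_mem_nhds hs.1 hs.2
    have hIoo : ∀ s ∈ Set.Ioo (0:ℝ) 1, s ∈ Set.Icc (0:ℝ) 1 := fun s hs => ⟨hs.1.le, hs.2.le⟩
    refine (hasDerivAt_integral_of_dominated_loc_of_deriv_le (bound := fun _ => B' * (2 * r))
      hnh ?_ ?_ (F' := fun s w => fderiv ℝ u (a + s • (w - a)) (w - a)) ?_ ?_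
      (integrable_const _) ?_).2
    · filter_upwards [hnh] with s hs
      exact ((hucs s (hIoo s hs)).integrableOn_compact hQ).aestronglyMeasurable
    · exact (hucs s (hIoo s hs)).integrableOn_compact hQ
    · exact (((hdcs s (hIoo s hs)).clm_apply
        (by fun_prop)).integrableOn_compact hQ).aestronglyMeasurable
    · filter_upwards [hae] with w hw s hs
      refine ((fderiv ℝ u (a + s • (w - a))).le_opNorm (w - a)).trans ?_
      have h1 := hB' _ (hmem s (hIoo s hs) w hw)
      exact mul_le_mul h1 (hnorm w hw) (norm_nonneg _) ((norm_nonneg _).trans h1)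
    · filter_upwards [hae] with w hw s hs
      have h1 : HasFDerivAt u (fderiv ℝ u (a + s • (w - a))) (a + s • (w - a)) :=
        ((hu.contDiffAt (hV.mem_nhds (hQV (hmem s (hIoo s hs) w hw)))).differentiableAt
          one_ne_zero).hasFDerivAt
      have h2 : HasDerivAt (fun s : ℝ => a + s • (w - a)) (w - a) s := by
        simpa using ((hasDerivAt_id s).smul_const (w - a)).const_add a
      exact h1.comp_hasDerivAt s h2
  set K := 2 * r * (μ.real Q ^ (1 - 1 / p) * J ^ (1 / p)) with hK
  have hgb : ∀ s ∈ Set.Ioo (0:ℝ) 1,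
      |∫ w in Q, fderiv ℝ u (a + s • (w - a)) (w - a) ∂μ| ≤ K * s ^ (-γ) := by
    intro s hs
    have hs' : s ∈ Set.Icc (0:ℝ) 1 := ⟨hs.1.le, hs.2.le⟩
    have hs0 := hs.1
    have hci : IntegrableOn (fun w => ‖fderiv ℝ u (a + s • (w - a))‖) Q μ :=
      (hdcs s hs').norm.integrableOn_compact hQ
    have h1 : |∫ w in Q, fderiv ℝ u (a + s • (w - a)) (w - a) ∂μ| ≤
        ∫ w in Q, 2 * r * ‖fderiv ℝ u (a + s • (w - a))‖ ∂μ := by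
      rw [← Real.norm_eq_abs]
      refine norm_integral_le_of_norm_le (hci.const_mul (2 * r)) ?_
      filter_upwards [hae] with w hw
      have h1 := (fderiv ℝ u (a + s • (w - a))).le_opNorm (w - a)
      refine h1.trans ?_
      rw [mul_comm]
      exact mul_le_mul_of_nonneg_right (hnorm w hw) (norm_nonneg _)
    rw [integral_const_mul] at h1
    have h2 := aux_holder μ hQ (hdcs s hs').norm (fun _ _ => norm_nonneg _) hp1
    have h3 := aux_scale μ hQ hQc (F := fun w => ‖fderiv ℝ u w‖ ^ p)
      (hdc.norm.rpow_const fun _ _ => Or.inr hp0.le) (fun _ _ => by positivity) ha hs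
    have h4 : (∫ w in Q, ‖fderiv ℝ u (a + s • (w - a))‖ ^ p ∂μ) ^ (1 / p) ≤
        s ^ (-γ) * J ^ (1 / p) := by
      refine (Real.rpow_le_rpow (integral_nonneg fun w => by positivity) h3
        (by positivity)).trans_eq ?_
      rw [Real.mul_rpow (by positivity) hJ0, ← Real.rpow_natCast, ← Real.rpow_neg hs0.le,
        ← Real.rpow_mul hs0.le]
      congr 2
      rw [hγ]; ring
    calc _ ≤ _ := h1
      _ ≤ 2 * r * (μ.real Q ^ (1 - 1 / p) * (s ^ (-γ) * J ^ (1 / p))) := by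
        gcongr
        exact h2.trans (by gcongr)
      _ = K * s ^ (-γ) := by rw [hK]; ring
  have hhd : ∀ s ∈ Set.Ioo (0:ℝ) 1,
      HasDerivAt (fun s : ℝ => K / (1 - γ) * s ^ (1 - γ)) (K * s ^ (-γ)) s := by
    intro s hs
    have h := (Real.hasDerivAt_rpow_const (p := 1 - γ) (Or.inl hs.1.ne')).const_mul (K / (1 - γ))
    refine h.congr_deriv ?_
    have : 1 - γ ≠ 0 := by linarith
    rw [show 1 - γ - 1 = -γ by ring]
    field_simp
  have hhc : ContinuousOn (fun s : ℝ => K / (1 - γ) * s ^ (1 - γ)) (Set.Icc 0 1) :=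
    continuousOn_const.mul (continuousOn_id.rpow_const fun _ _ => Or.inr (by linarith))
  have key : ∀ ε : ℝ, |ε| ≤ 1 → 0 ≤ K / (1 - γ) + ε * (g 1 - g 0) := by
    intro ε hε
    have hm : MonotoneOn (fun s : ℝ => K / (1 - γ) * s ^ (1 - γ) + ε * g s) (Set.Icc 0 1) := by
      have hD : ∀ s ∈ Set.Ioo (0:ℝ) 1, HasDerivAt
          (fun s : ℝ => K / (1 - γ) * s ^ (1 - γ) + ε * g s) _ s := fun s hs =>
        (hhd s hs).add ((hgd s hs).const_mul ε)
      refine monotoneOn_of_deriv_nonneg (convex_Icc 0 1) (hhc.add (hgc.const_mul ε)) ?_ ?_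
      · rw [interior_Icc]
        exact fun s hs => (hD s hs).differentiableAt.differentiableWithinAt
      · rw [interior_Icc]
        intro s hs
        rw [(hD s hs).deriv]
        have h1 := hgb s hs
        have h2 := neg_abs_le (ε * ∫ w in Q, fderiv ℝ u (a + s • (w - a)) (w - a) ∂μ)
        rw [abs_mul] at h2
        nlinarith [abs_nonneg (∫ w in Q, fderiv ℝ u (a + s • (w - a)) (w - a) ∂μ)]
    have := hm (Set.left_mem_Icc.2 zero_le_one) (Set.right_mem_Icc.2 zero_le_one) zero_le_one
    simp only [Real.one_rpow, Real.zero_rpow (by linarith : 1 - γ ≠ 0)] at this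
    linarith
  have hg1 : g 1 = ∫ w in Q, u w ∂μ := by simp [hg]
  have hg0 : g 0 = μ.real Q * u a := by simp [hg]
  rw [← hg1, ← hg0]
  have e : 2 * r / (1 - γ) * (μ.real Q ^ (1 - 1 / p) * J ^ (1 / p)) = K / (1 - γ) := by
    rw [hK]; ring
  rw [e, abs_le]
  constructor
  · linarith [key 1 (by simp)]
  · linarith [key (-1) (by simp)]

lemma aux_osc {V : Set E} (hV : IsOpen V) {u : E → ℝ} (hu : ContDiffOn ℝ 1 u V)
    {z : E} {r : ℝ} (hr : 0 < r) (hQV : Metric.closedBall z r ⊆ V) {p : ℝ} (hp1 : 1 < p)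
    (hp : (Module.finrank ℝ E : ℝ) < p) {M : ℝ}
    (hM : (∫ w in Metric.closedBall z r, ‖fderiv ℝ u w‖ ^ p ∂μ) ^ (1 / p) ≤ M)
    {a : E} (ha : a ∈ Metric.closedBall z r) :
    |(∫ w in Metric.closedBall z r, u w ∂μ) / μ.real (Metric.closedBall z r) - u a| ≤
      2 / (1 - Module.finrank ℝ E / p) * μ.real (Metric.ball (0:E) 1) ^ (- 1 / p) *
        r ^ (1 - Module.finrank ℝ E / p) * M := by
  have hp0 : 0 < p := by linarith
  have h := aux_morrey μ hV hu hr hQV hp1 hp ha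
  have hγ1 : (Module.finrank ℝ E : ℝ) / p < 1 := by rw [div_lt_one hp0]; exact hp
  have hv : 0 < μ.real (Metric.ball (0:E) 1) :=
    ENNReal.toReal_pos (Metric.measure_ball_pos μ 0 one_pos).ne' measure_ball_lt_top.ne
  have hm := Measure.addHaar_real_closedBall μ z hr.le
  set v := μ.real (Metric.ball (0:E) 1)
  set m := μ.real (Metric.closedBall z r) with hmdef
  have hm0 : 0 < m := by rw [hm]; positivity
  have e1 : (∫ w in Metric.closedBall z r, u w ∂μ) / m - u a =
    ((∫ w in Metric.closedBall z r, u w ∂μ) - m * u a) / m := by field_simp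
  rw [e1, abs_div, abs_of_pos hm0, div_le_iff₀ hm0]
  have h1g : 0 < 1 - (Module.finrank ℝ E : ℝ) / p := by linarith
  refine h.trans ?_
  have e2 : m ^ (1 - 1 / p) = v ^ (-1 / p) * r ^ (-(Module.finrank ℝ E : ℝ) / p) * m := by
    rw [sub_eq_add_neg, Real.rpow_add hm0, Real.rpow_one, mul_comm]
    congr 1
    rw [hm, Real.mul_rpow (by positivity) hv.le, ← Real.rpow_natCast, ← Real.rpow_mul hr.le,
      mul_comm]
    congr 2 <;> ring
  have e3 : r ^ (1 - (Module.finrank ℝ E : ℝ) / p) =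
      r * r ^ (-(Module.finrank ℝ E : ℝ) / p) := by
    rw [sub_eq_add_neg, Real.rpow_add hr, Real.rpow_one, neg_div]
  rw [e2, e3]
  calc _ = 2 * r / (1 - Module.finrank ℝ E / p) * (v ^ (-1 / p) *
        r ^ (-(Module.finrank ℝ E : ℝ) / p) * m) *
          (∫ w in Metric.closedBall z r, ‖fderiv ℝ u w‖ ^ p ∂μ) ^ (1 / p) := by ring
    _ ≤ 2 * r / (1 - Module.finrank ℝ E / p) * (v ^ (-1 / p) *
        r ^ (-(Module.finrank ℝ E : ℝ) / p) * m) * M := by gcongr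
    _ = _ := by ring

lemma aux_avg {V : Set E} {u : E → ℝ} (hu : ContinuousOn u V)
    {z : E} {r : ℝ} (hr : 0 < r) (hQV : Metric.closedBall z r ⊆ V) {p : ℝ} (hp1 : 1 < p) :
    |(∫ w in Metric.closedBall z r, u w ∂μ) / μ.real (Metric.closedBall z r)| ≤
      μ.real (Metric.closedBall z r) ^ (- 1 / p) *
        (∫ w in Metric.closedBall z r, |u w| ^ p ∂μ) ^ (1 / p) := by
  have hm0 : 0 < μ.real (Metric.closedBall z r) :=
    ENNReal.toReal_pos (Metric.measure_closedBall_pos μ z hr).ne' measure_closedBall_lt_top.ne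
  have h := aux_holder μ (isCompact_closedBall z r) (hu.mono hQV).abs (fun _ _ => abs_nonneg _) hp1
  have h1 : |∫ w in Metric.closedBall z r, u w ∂μ| ≤ ∫ w in Metric.closedBall z r, |u w| ∂μ :=
    abs_integral_le_integral_abs
  rw [abs_div, abs_of_pos hm0, div_le_iff₀ hm0]
  refine (h1.trans h).trans_eq ?_
  rw [sub_eq_add_neg, Real.rpow_add hm0, Real.rpow_one, neg_div]
  ring

end generic

section geom
variable {E : Type*} [NormedAddCommGroup E] [NormedSpace ℝ E]

lemma geo_cone {U : Set E} (hUo : IsOpen U) {φ : E → ℝ} (hφ : ContDiff ℝ 1 φ)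
    (hUφ : U = {p | φ p < 0}) (hφgrad : ∀ p ∈ frontier U, fderiv ℝ φ p ≠ 0)
    {x₀ : E} (hx₀ : x₀ ∈ closure U) :
    ∃ (e : E) (c δ t₀ : ℝ), 0 < c ∧ 0 < δ ∧ 0 < t₀ ∧ ∀ x ∈ closure U, dist x x₀ < δ →
      ∀ t, 0 < t → t ≤ t₀ → Metric.closedBall (x + t • e) (c * t) ⊆ U := by
  by_cases hxU : x₀ ∈ U
  · obtain ⟨ε, hε, hb⟩ := Metric.isOpen_iff.1 hUo x₀ hxU
    refine ⟨0, 1, ε / 2, ε / 4, one_pos, by positivity, by positivity, ?_⟩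
    intro x _ hx t ht ht0 y hy
    apply hb
    simp only [smul_zero, add_zero, one_mul, Metric.mem_closedBall] at hy
    rw [Metric.mem_ball]
    linarith [dist_triangle y x x₀]
  · have hfr : x₀ ∈ frontier U := by
      rw [hUo.frontier_eq]; exact ⟨hx₀, hxU⟩
    have hne := hφgrad x₀ hfr
    set L := fderiv ℝ φ x₀ with hL
    obtain ⟨e₀, he₀⟩ : ∃ e, L e ≠ 0 := by
      by_contra! h
      exact hne (ContinuousLinearMap.ext h)
    set e := -(L e₀)⁻¹ • e₀ with he
    have hLe : L e = -1 := by
      rw [he, map_smul, smul_eq_mul]; field_simp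
    have hle : ∀ x ∈ closure U, φ x ≤ 0 := by
      have : closure U ⊆ {x | φ x ≤ 0} := by
        refine closure_minimal ?_ (isClosed_le hφ.continuous continuous_const)
        rw [hUφ]; exact fun x hx => (show φ x ≤ 0 from le_of_lt hx)
      exact fun x hx => this hx
    have hs : HasStrictFDerivAt φ L x₀ := hφ.contDiffAt.hasStrictFDerivAt one_ne_zero
    set ε : ℝ := 1 / (4 * (‖e‖ + 1)) with hε
    have hε0 : 0 < ε := by positivity
    set c : ℝ := 1 / (4 * (‖L‖ + 1)) with hc
    have hc0 : 0 < c := by positivity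
    have hc1 : c ≤ 1 := by
      rw [hc, div_le_one (by positivity)]; linarith [norm_nonneg L]
    have hev := hs.isLittleO.bound hε0
    rw [Metric.eventually_nhds_iff] at hev
    obtain ⟨η, hη, hev⟩ := hev
    refine ⟨e, c, η / 2, η / (4 * (‖e‖ + 1)), hc0, by positivity, by positivity, ?_⟩
    intro x hx hxd t ht ht0 y hy
    have hw : ‖y - (x + t • e)‖ ≤ c * t := by rwa [← dist_eq_norm]
    have hyx : ‖y - x‖ ≤ t * (‖e‖ + 1) := by
      have : y - x = (y - (x + t • e)) + t • e := by abel
      rw [this]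
      refine (norm_add_le _ _).trans ?_
      rw [norm_smul, Real.norm_of_nonneg ht.le]
      nlinarith
    have ht1 : t * (‖e‖ + 1) ≤ η / 4 := by
      rw [le_div_iff₀ (by positivity)] at ht0
      linarith
    have hyd : dist y x₀ < η := by
      have : dist y x ≤ η / 4 := by rw [dist_eq_norm]; exact hyx.trans ht1
      linarith [dist_triangle y x x₀]
    have h := hev (y := (y, x)) (by
      rw [Prod.dist_eq]; exact max_lt hyd (by simp; linarith))
    simp only at h
    rw [Real.norm_eq_abs, abs_le] at h
    have h2 : L (y - x) ≤ -t + ‖L‖ * (c * t) := by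
      have : y - x = (y - (x + t • e)) + t • e := by abel
      rw [this, map_add, map_smul, hLe, smul_eq_mul]
      have h3 := (le_abs_self _).trans (L.le_opNorm (y - (x + t • e)))
      have h4 := mul_le_mul_of_nonneg_left hw (norm_nonneg L)
      linarith
    have h5 : ‖L‖ * (c * t) ≤ t / 4 := by
      have : ‖L‖ * c ≤ 1 / 4 := by
        rw [hc, mul_one_div, div_le_div_iff₀ (by positivity) (by norm_num)]
        linarith
      nlinarith
    have h6 : ε * ‖y - x‖ ≤ t / 4 := by
      have : ε * ‖y - x‖ ≤ ε * (t * (‖e‖ + 1)) := by gcongr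
      have h7 : ε * (t * (‖e‖ + 1)) = t / 4 := by rw [hε]; field_simp
      linarith
    have : φ y < 0 := by linarith [hle x hx, h.2]
    rw [hUφ]; exact this

/-- Interior estimates at scale `r`. -/
def GoodEst (U : Set E) (β N : ℝ) (u : E → ℝ) : Prop :=
  ∀ z r, 0 < r → Metric.closedBall z (2 * r) ⊆ U →
    (∀ a ∈ Metric.closedBall z r, ∀ b ∈ Metric.closedBall z r, |u a - u b| ≤ N * r ^ β) ∧
    (∀ a ∈ Metric.closedBall z r, |u a| ≤ N * (r ^ β + r ^ (β - 1)))

lemma geo_chain {U : Set E} {β : ℝ} (hβ : 0 < β) {e : E} {c t₀ : ℝ}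
    (hc : 0 < c) : ∃ C > 0, ∀ (u : E → ℝ) (N : ℝ), 0 ≤ N → ContinuousOn u (closure U) →
      GoodEst U β N u → ∀ x ∈ closure U,
      (∀ t, 0 < t → t ≤ t₀ → Metric.closedBall (x + t • e) (c * t) ⊆ U) →
      ∀ t, 0 < t → t ≤ t₀ → |u (x + t • e) - u x| ≤ C * N * t ^ β := by
  set M := 2 * ‖e‖ + c with hM
  have hM0 : 0 < M := by positivity
  have hcM : c ≤ M := by linarith [norm_nonneg e]
  set θ : ℝ := 1 - c / (2 * M) with hθ
  have hcd : c / (2 * M) ≤ 1 / 2 := by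
    rw [div_le_div_iff₀ (by positivity) (by norm_num)]; linarith
  have hcd0 : 0 < c / (2 * M) := by positivity
  have hθ0 : 0 < θ := by linarith
  have hθ1 : θ < 1 := by linarith
  have hθb : θ ^ β < 1 := Real.rpow_lt_one hθ0.le hθ1 hβ
  refine ⟨(c / 2) ^ β / (1 - θ ^ β), div_pos (by positivity) (by linarith), ?_⟩
  intro u N hN huc hgood x hx hball t ht htt
  set f : ℕ → ℝ := fun k => u (x + (θ ^ k * t) • e) with hf
  have hk0 : ∀ k : ℕ, 0 < θ ^ k * t := fun k => by positivity
  have hk1 : ∀ k : ℕ, θ ^ k * t ≤ t₀ := fun k =>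
    (mul_le_of_le_one_left ht.le (pow_le_one₀ hθ0.le hθ1.le)).trans htt
  have hstep : ∀ k, dist (f k) (f (k + 1)) ≤ (N * (c / 2 * t) ^ β) * (θ ^ β) ^ k := by
    intro k
    have hb := hball _ (hk0 k) (hk1 k)
    have hr : 0 < c / 2 * (θ ^ k * t) := mul_pos (by positivity) (hk0 k)
    have h := (hgood (x + (θ ^ k * t) • e) (c / 2 * (θ ^ k * t)) hr (by
      convert hb using 2; ring)).1 (x + (θ ^ k * t) • e) (Metric.mem_closedBall_self hr.le)
      (x + (θ ^ (k + 1) * t) • e) (by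
        rw [Metric.mem_closedBall, dist_eq_norm]
        have e1 : x + (θ ^ (k + 1) * t) • e - (x + (θ ^ k * t) • e) =
            (-(θ ^ k * t * (c / (2 * M)))) • e := by
          rw [add_sub_add_left_eq_sub, ← sub_smul]
          congr 1
          rw [hθ]; ring
        rw [e1, norm_smul, norm_neg, Real.norm_of_nonneg (by positivity)]
        have h3 : c / (2 * M) * ‖e‖ ≤ c / 2 := by
          rw [div_mul_eq_mul_div, div_le_div_iff₀ (by positivity) (by norm_num)]
          nlinarith [norm_nonneg e]
        have := mul_le_mul_of_nonneg_left h3 (hk0 k).le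
        linarith)
    rw [Real.dist_eq]
    refine h.trans_eq ?_
    rw [show c / 2 * (θ ^ k * t) = (c / 2 * t) * θ ^ k by ring,
      Real.mul_rpow (by positivity) (by positivity), ← Real.rpow_natCast, ← Real.rpow_natCast,
      ← Real.rpow_mul hθ0.le, ← Real.rpow_mul hθ0.le, mul_comm (k : ℝ) β]
    ring
  have hlim : Filter.Tendsto f Filter.atTop (nhds (u x)) := by
    have h1 : Filter.Tendsto (fun k : ℕ => x + (θ ^ k * t) • e) Filter.atTop (nhds x) := by
      have h2 := tendsto_pow_atTop_nhds_zero_of_lt_one hθ0.le hθ1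
      have h3 := ((h2.mul_const t).smul_const e).const_add x
      simpa using h3
    refine (huc x hx).tendsto.comp (tendsto_nhdsWithin_iff.2 ⟨h1, ?_⟩)
    filter_upwards with k
    exact subset_closure (hball _ (hk0 k) (hk1 k)
      (Metric.mem_closedBall_self (mul_pos hc (hk0 k)).le))
  have h := dist_le_of_le_geometric_of_tendsto₀ _ _ hθb hstep hlim
  rw [Real.dist_eq] at h
  simp only [hf, pow_zero, one_mul] at h
  refine h.trans_eq ?_
  rw [Real.mul_rpow (by positivity) ht.le]
  ring

lemma geo_local {U : Set E} (hUo : IsOpen U) {φ : E → ℝ} (hφ : ContDiff ℝ 1 φ)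
    (hUφ : U = {p | φ p < 0}) (hφgrad : ∀ p ∈ frontier U, fderiv ℝ φ p ≠ 0)
    {β : ℝ} (hβ : 0 < β) {x₀ : E} (hx₀ : x₀ ∈ closure U) :
    ∃ δ > 0, ∃ C > 0, ∀ (u : E → ℝ) (N : ℝ), 0 ≤ N → ContinuousOn u (closure U) →
      GoodEst U β N u →
      (∀ x ∈ closure U, dist x x₀ < δ → |u x| ≤ C * N) ∧
      (∀ x ∈ closure U, ∀ y ∈ closure U, dist x x₀ < δ → dist y x₀ < δ →
        |u x - u y| ≤ C * N * dist x y ^ β) := by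
  obtain ⟨e, c, δ, t₀, hc, hδ, ht₀, hcone⟩ := geo_cone hUo hφ hUφ hφgrad hx₀
  obtain ⟨C, hC, hch⟩ := geo_chain (U := U) hβ (e := e) (t₀ := t₀) hc
  set k := 2 / c with hk
  have hk0 : 0 < k := by positivity
  set r₀ := c / 2 * t₀ with hr₀
  have hr₀0 : 0 < r₀ := by positivity
  set C1 := C * t₀ ^ β + (r₀ ^ β + r₀ ^ (β - 1)) with hC1
  set C2 := 2 * (C * k ^ β) + 1 with hC2
  have hC10 : 0 < C1 := by positivity
  have hC20 : 0 < C2 := by positivity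
  refine ⟨min δ (t₀ / (2 * k)), lt_min hδ (by positivity), C1 + C2, by positivity, ?_⟩
  intro u N hN huc hgood
  constructor
  · intro x hx hxd
    have hb := hcone x hx (hxd.trans_le (min_le_left _ _))
    have h1 := hch u N hN huc hgood x hx hb t₀ ht₀ le_rfl
    have h2 := (hgood (x + t₀ • e) r₀ hr₀0 (by
      convert hb t₀ ht₀ le_rfl using 2; rw [hr₀]; ring)).2 _ (Metric.mem_closedBall_self hr₀0.le)
    have h3 : |u x| ≤ |u (x + t₀ • e)| + |u (x + t₀ • e) - u x| := by
      rw [abs_sub_comm]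
      have := abs_add_le (u (x + t₀ • e)) (u x - u (x + t₀ • e))
      simpa using this
    calc |u x| ≤ N * (r₀ ^ β + r₀ ^ (β - 1)) + C * N * t₀ ^ β := by linarith
      _ = C1 * N := by rw [hC1]; ring
      _ ≤ (C1 + C2) * N := by gcongr; linarith
  · intro x hx y hy hxd hyd
    rcases eq_or_ne x y with rfl | hxy
    · simp only [sub_self, abs_zero]; positivity
    have hd : 0 < dist x y := dist_pos.2 hxy
    have hbx := hcone x hx (hxd.trans_le (min_le_left _ _))
    have hby := hcone y hy (hyd.trans_le (min_le_left _ _))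
    set t := k * dist x y with ht
    have ht0 : 0 < t := by positivity
    have htt : t ≤ t₀ := by
      have h1 : dist x y ≤ t₀ / (2 * k) + t₀ / (2 * k) :=
        (dist_triangle_right x y x₀).trans (add_le_add (hxd.le.trans (min_le_right _ _))
          (hyd.le.trans (min_le_right _ _)))
      calc t ≤ k * (t₀ / (2 * k) + t₀ / (2 * k)) := by rw [ht]; gcongr
        _ = t₀ := by field_simp; ring
    have h1 := hch u N hN huc hgood x hx hbx t ht0 htt
    have h2 := hch u N hN huc hgood y hy hby t ht0 htt
    have hct : c * t = 2 * dist x y := by rw [ht, hk]; field_simp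
    have h3 := (hgood (x + t • e) (dist x y) hd (by
      rw [← hct]; exact hbx t ht0 htt)).1 (x + t • e) (Metric.mem_closedBall_self hd.le)
      (y + t • e) (by rw [Metric.mem_closedBall, dist_add_right, dist_comm])
    rw [abs_le] at h1 h2 h3
    have h4 : |u x - u y| ≤ N * dist x y ^ β + 2 * (C * N * t ^ β) := by
      rw [abs_le]; constructor <;> linarith
    rw [ht, Real.mul_rpow hk0.le hd.le] at h4
    calc |u x - u y| ≤ _ := h4
      _ = C2 * N * dist x y ^ β := by rw [hC2]; ring
      _ ≤ _ := by gcongr; linarith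

lemma geo_global [FiniteDimensional ℝ E] {U : Set E} (hUo : IsOpen U)
    (hUb : Bornology.IsBounded U) {φ : E → ℝ} (hφ : ContDiff ℝ 1 φ)
    (hUφ : U = {p | φ p < 0}) (hφgrad : ∀ p ∈ frontier U, fderiv ℝ φ p ≠ 0)
    {β : ℝ} (hβ : 0 < β) :
    ∃ C > 0, ∀ (u : E → ℝ) (N : ℝ), 0 ≤ N → ContinuousOn u (closure U) →
      GoodEst U β N u →
      (∀ x ∈ closure U, |u x| ≤ C * N) ∧
      (∀ x ∈ closure U, ∀ y ∈ closure U, |u x - u y| ≤ C * N * dist x y ^ β) := by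
  have hK : IsCompact (closure U) := by
    have := FiniteDimensional.proper ℝ E
    exact hUb.isCompact_closure
  obtain ⟨C1, hC1, H1⟩ : ∃ C > 0, ∀ (u : E → ℝ) (N : ℝ), 0 ≤ N → ContinuousOn u (closure U) →
      GoodEst U β N u → ∀ x ∈ closure U, |u x| ≤ C * N := by
    refine hK.induction_on (p := fun S => ∃ C > 0, ∀ (u : E → ℝ) (N : ℝ), 0 ≤ N →
      ContinuousOn u (closure U) → GoodEst U β N u → ∀ x ∈ S, |u x| ≤ C * N) ?_ ?_ ?_ ?_
    · exact ⟨1, one_pos, by simp⟩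
    · rintro s t hst ⟨C, hC, h⟩
      exact ⟨C, hC, fun u N hN hc hg x hx => h u N hN hc hg x (hst hx)⟩
    · rintro s t ⟨C, hC, h⟩ ⟨C', hC', h'⟩
      refine ⟨C + C', by positivity, ?_⟩
      rintro u N hN hc hg x (hx | hx)
      · refine (h u N hN hc hg x hx).trans ?_
        gcongr; linarith
      · refine (h' u N hN hc hg x hx).trans ?_
        gcongr; linarith
    · intro x₀ hx₀
      obtain ⟨δ, hδ, C, hC, h⟩ := geo_local hUo hφ hUφ hφgrad hβ hx₀
      refine ⟨closure U ∩ Metric.ball x₀ δ, inter_mem_nhdsWithin _ (Metric.ball_mem_nhds x₀ hδ),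
        C, hC, ?_⟩
      intro u N hN hc hg x hx
      exact (h u N hN hc hg).1 x hx.1 hx.2
  obtain ⟨C2, hC2, H2⟩ : ∃ C > 0, ∀ (u : E → ℝ) (N : ℝ), 0 ≤ N → ContinuousOn u (closure U) →
      GoodEst U β N u → ∀ q ∈ closure U ×ˢ closure U, |u q.1 - u q.2| ≤
        C * N * dist q.1 q.2 ^ β := by
    refine (hK.prod hK).induction_on (p := fun S => ∃ C > 0, ∀ (u : E → ℝ) (N : ℝ), 0 ≤ N →
      ContinuousOn u (closure U) → GoodEst U β N u → ∀ q ∈ S, |u q.1 - u q.2| ≤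
        C * N * dist q.1 q.2 ^ β) ?_ ?_ ?_ ?_
    · exact ⟨1, one_pos, by simp⟩
    · rintro s t hst ⟨C, hC, h⟩
      exact ⟨C, hC, fun u N hN hc hg x hx => h u N hN hc hg x (hst hx)⟩
    · rintro s t ⟨C, hC, h⟩ ⟨C', hC', h'⟩
      refine ⟨C + C', by positivity, ?_⟩
      rintro u N hN hc hg x (hx | hx)
      · refine (h u N hN hc hg x hx).trans ?_
        gcongr; linarith
      · refine (h' u N hN hc hg x hx).trans ?_
        gcongr; linarith
    · rintro ⟨x₀, y₀⟩ ⟨hx₀, hy₀⟩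
      rcases eq_or_ne x₀ y₀ with rfl | hne
      · obtain ⟨δ, hδ, C, hC, h⟩ := geo_local hUo hφ hUφ hφgrad hβ hx₀
        refine ⟨(closure U ×ˢ closure U) ∩ (Metric.ball x₀ δ ×ˢ Metric.ball x₀ δ),
          inter_mem_nhdsWithin _ (prod_mem_nhds (Metric.ball_mem_nhds x₀ hδ)
            (Metric.ball_mem_nhds x₀ hδ)), C, hC, ?_⟩
        rintro u N hN hc hg ⟨x, y⟩ ⟨⟨hx, hy⟩, hx', hy'⟩
        exact (h u N hN hc hg).2 x hx y hy hx' hy'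
      · have hd : 0 < dist x₀ y₀ := dist_pos.2 hne
        have hd2 : 0 < dist x₀ y₀ / 2 := by positivity
        refine ⟨(closure U ×ˢ closure U) ∩ {q | dist x₀ y₀ / 2 < dist q.1 q.2},
          inter_mem_nhdsWithin _ ((isOpen_lt continuous_const
            (continuous_fst.dist continuous_snd)).mem_nhds (by
              simp only [Set.mem_ofPred_eq]; linarith)), 2 * C1 / (dist x₀ y₀ / 2) ^ β,
              by positivity, ?_⟩
        rintro u N hN hc hg ⟨x, y⟩ ⟨⟨hx, hy⟩, hxy⟩
        simp only [Set.mem_ofPred_eq] at hxy hx hy ⊢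
        have h1 := H1 u N hN hc hg x hx
        have h2 := H1 u N hN hc hg y hy
        calc |u x - u y| ≤ 2 * C1 * N := by linarith [abs_sub (u x) (u y)]
          _ = 2 * C1 / (dist x₀ y₀ / 2) ^ β * N * (dist x₀ y₀ / 2) ^ β := by
            field_simp
          _ ≤ _ := by gcongr
  refine ⟨C1 + C2, by positivity, fun u N hN hc hg => ⟨fun x hx => ?_, fun x hx y hy => ?_⟩⟩
  · refine (H1 u N hN hc hg x hx).trans ?_
    gcongr; linarith
  · refine (H2 u N hN hc hg (x, y) ⟨hx, hy⟩).trans ?_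
    gcongr; linarith

end geom

lemma aux_weight {n : ℕ} {U : Set ((Fin n → ℝ) × ℝ)} (hUo : IsOpen U)
    (hUb : Bornology.IsBounded U) (hUpos : U ⊆ {p : (Fin n → ℝ) × ℝ | 0 < p.2})
    {α p : ℝ} (hα : 0 < α) (hp : 0 < p) {F : (Fin n → ℝ) × ℝ → ℝ}
    (hF : ContinuousOn F (closure U)) (hF0 : ∀ x, 0 ≤ F x) {z : (Fin n → ℝ) × ℝ} {r : ℝ}
    (hr : 0 < r) (hz : Metric.closedBall z (2 * r) ⊆ U) {N : ℝ} (hN : 0 ≤ N)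
    (hNF : ∫ w in U, w.2 ^ (p * α) * F w ≤ N ^ p) :
    (∫ w in Metric.closedBall z r, F w) ^ (1 / p) ≤ r ^ (-α) * N := by
  have hK : IsCompact (closure U) := hUb.isCompact_closure
  have hQU : Metric.closedBall z r ⊆ U :=
    (Metric.closedBall_subset_closedBall (by linarith)).trans hz
  have hpα : 0 < p * α := mul_pos hp hα
  have hz2 : 2 * r < z.2 := by
    have h1 : ((z.1, z.2 - 2 * r) : (Fin n → ℝ) × ℝ) ∈ U := by
      apply hz
      rw [Metric.mem_closedBall, Prod.dist_eq]
      refine max_le (by simp; linarith) ?_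
      simp [Real.dist_eq, abs_of_pos hr]
    have h2 : 0 < z.2 - 2 * r := hUpos h1
    linarith
  have hw2 : ∀ w ∈ Metric.closedBall z r, r ≤ w.2 := by
    intro w hw
    rw [Metric.mem_closedBall, Prod.dist_eq] at hw
    have h1 := (le_max_right _ _).trans hw
    rw [Real.dist_eq, abs_le] at h1
    linarith [h1.1]
  have hcont : ContinuousOn (fun w : (Fin n → ℝ) × ℝ => w.2 ^ (p * α) * F w) (closure U) :=
    (continuous_snd.continuousOn.rpow_const fun _ _ => Or.inr hpα.le).mul hF
  have hint : IntegrableOn (fun w : (Fin n → ℝ) × ℝ => w.2 ^ (p * α) * F w) U :=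
    (hcont.integrableOn_compact hK).mono_set subset_closure
  have hFi : IntegrableOn F (Metric.closedBall z r) :=
    (hF.integrableOn_compact hK).mono_set (hQU.trans subset_closure)
  have h1 : r ^ (p * α) * ∫ w in Metric.closedBall z r, F w ≤ N ^ p := by
    refine le_trans ?_ hNF
    rw [← integral_const_mul]
    refine (setIntegral_mono_on (hFi.const_mul _) (hint.mono_set hQU)
      Metric.isClosed_closedBall.measurableSet fun w hw => ?_).trans
      (setIntegral_mono_set hint ?_ (Filter.Eventually.of_forall hQU))
    · have := hw2 w hw
      exact mul_le_mul_of_nonneg_right (Real.rpow_le_rpow hr.le this hpα.le) (hF0 w)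
    · filter_upwards [ae_restrict_mem hUo.measurableSet] with w hw
      have : 0 < w.2 := hUpos hw
      exact mul_nonneg (by positivity) (hF0 w)
  have h2 : ∫ w in Metric.closedBall z r, F w ≤ (r ^ (-α) * N) ^ p := by
    rw [Real.mul_rpow (by positivity) hN, ← Real.rpow_mul hr.le,
      show -α * p = -(p * α) by ring, Real.rpow_neg hr.le, ← div_eq_inv_mul,
      le_div_iff₀ (by positivity)]
    linarith
  have h3 := Real.rpow_le_rpow (integral_nonneg hF0) h2 (by positivity : 0 ≤ 1 / p)
  rwa [← Real.rpow_mul (by positivity), mul_one_div_cancel hp.ne', Real.rpow_one] at h3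


/-- The Hölder-embedding case (A61) of the weighted Sobolev embedding
`W^{1,p}_α(U) ↪ C^β(closure U)`, stated as the corresponding inequality for
functions of class `C¹` on a neighborhood of `closure U`. -/
theorem weighted_sobolev_embedding_holder (n : ℕ) (U : Set ((Fin n → ℝ) × ℝ))
    (hUo : IsOpen U) (hUconn : IsConnected U) (hUb : Bornology.IsBounded U)
    (hUpos : U ⊆ {p : (Fin n → ℝ) × ℝ | 0 < p.2})
    (φ : (Fin n → ℝ) × ℝ → ℝ) (hφ : ContDiff ℝ 1 φ)
    (hUφ : U = {p | φ p < 0})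
    (hφgrad : ∀ p ∈ frontier U, fderiv ℝ φ p ≠ 0)
    (hfr : (frontier U ∩ {p : (Fin n → ℝ) × ℝ | p.2 = 0}).Nonempty)
    (α p : ℝ) (hα : α ∈ Set.Ioo (0 : ℝ) 1) (hp : (n + 1) / (1 - α) < p)
    (β : ℝ) (hβ : β = 1 - α - (n + 1) / p) :
    ∃ C > 0, ∀ (u : (Fin n → ℝ) × ℝ → ℝ) (V : Set ((Fin n → ℝ) × ℝ)),
      IsOpen V → closure U ⊆ V → ContDiffOn ℝ 1 u V →
      (∀ x ∈ closure U, |u x| ≤ C *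
        ((∫ z in U, z.2 ^ (p * α) * ‖fderiv ℝ u z‖ ^ p) +
          (∫ z in U, z.2 ^ (p * α) * |u z| ^ p)) ^ (1 / p)) ∧
      (∀ x ∈ closure U, ∀ y ∈ closure U, |u x - u y| ≤ C *
        ((∫ z in U, z.2 ^ (p * α) * ‖fderiv ℝ u z‖ ^ p) +
          (∫ z in U, z.2 ^ (p * α) * |u z| ^ p)) ^ (1 / p) * dist x y ^ β) := by
  have hα0 := hα.1
  have hα1 := hα.2
  have hn0 : (0 : ℝ) ≤ n := Nat.cast_nonneg n
  have hpn : (n : ℝ) + 1 < p * (1 - α) := by rwa [div_lt_iff₀ (by linarith)] at hp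
  have hp0 : 0 < p := lt_trans (by apply div_pos <;> linarith) hp
  have hpn1 : (n : ℝ) + 1 < p := by nlinarith
  have hp1 : 1 < p := by linarith
  have hβ0 : 0 < β := by
    have : ((n : ℝ) + 1) / p < 1 - α := by rw [div_lt_iff₀ hp0]; linarith
    rw [hβ]; linarith
  have := aux_haar n
  have hfr' : Module.finrank ℝ ((Fin n → ℝ) × ℝ) = n + 1 := by simp
  have hdp : (Module.finrank ℝ ((Fin n → ℝ) × ℝ) : ℝ) < p := by rw [hfr']; push_cast; exact hpn1
  have hdiv : ((n : ℝ) + 1) / p < 1 := by rw [div_lt_one hp0]; exact hpn1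
  have h1d : 0 < 1 - ((n : ℝ) + 1) / p := by linarith
  obtain ⟨C, hC, H⟩ := geo_global hUo hUb hφ hUφ hφgrad hβ0
  set v := (volume : Measure ((Fin n → ℝ) × ℝ)).real (Metric.ball 0 1) with hvdef
  have hv : 0 < v :=
    ENNReal.toReal_pos (Metric.measure_ball_pos volume 0 one_pos).ne' measure_ball_lt_top.ne
  set K1 := 2 / (1 - ((n : ℝ) + 1) / p) * v ^ (-1 / p) with hK1
  have hK10 : 0 < K1 := by positivity
  set K := 2 * K1 + v ^ (-1 / p) with hK
  have hK0 : 0 < K := by positivity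
  refine ⟨C * K, by positivity, ?_⟩
  intro u V hV hUV hu
  set A := ∫ z in U, z.2 ^ (p * α) * ‖fderiv ℝ u z‖ ^ p with hA
  set B := ∫ z in U, z.2 ^ (p * α) * |u z| ^ p with hB
  have hA0 : 0 ≤ A := setIntegral_nonneg hUo.measurableSet fun w hw => by
    have : 0 < w.2 := hUpos hw
    positivity
  have hB0 : 0 ≤ B := setIntegral_nonneg hUo.measurableSet fun w hw => by
    have : 0 < w.2 := hUpos hw
    positivity
  set N := (A + B) ^ (1 / p) with hN
  have hN0 : 0 ≤ N := by positivity
  have hNp : N ^ p = A + B := by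
    rw [hN, ← Real.rpow_mul (by positivity), one_div_mul_cancel hp0.ne', Real.rpow_one]
  have huc : ContinuousOn u (closure U) := hu.continuousOn.mono hUV
  have hdc : ContinuousOn (fderiv ℝ u) (closure U) :=
    (hu.continuousOn_fderiv_of_isOpen hV le_rfl).mono hUV
  have hgood : GoodEst U β (K * N) u := by
    intro z r hr hz
    have hQV : Metric.closedBall z r ⊆ V :=
      ((Metric.closedBall_subset_closedBall (by linarith)).trans hz).trans
        (subset_closure.trans hUV)
    have hM1 := aux_weight hUo hUb hUpos hα0 hp0 (F := fun w => ‖fderiv ℝ u w‖ ^ p)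
      (hdc.norm.rpow_const fun _ _ => Or.inr hp0.le) (fun _ => by positivity) hr hz hN0
      (by rw [hNp]; linarith)
    have hM2 := aux_weight hUo hUb hUpos hα0 hp0 (F := fun w => |u w| ^ p)
      (huc.abs.rpow_const fun _ _ => Or.inr hp0.le) (fun _ => by positivity) hr hz hN0
      (by rw [hNp]; linarith)
    set m := (∫ w in Metric.closedBall z r, u w) /
      (volume : Measure ((Fin n → ℝ) × ℝ)).real (Metric.closedBall z r) with hm
    have ho : ∀ a ∈ Metric.closedBall z r, |m - u a| ≤ K1 * N * r ^ β := by
      intro a ha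
      have h := aux_osc volume hV hu hr hQV hp1 hdp hM1 ha
      rw [hfr'] at h
      push_cast at h
      refine h.trans_eq ?_
      rw [hβ, show 1 - α - ((n : ℝ) + 1) / p = (1 - ((n : ℝ) + 1) / p) + -α by ring,
        Real.rpow_add hr]
      ring
    have hav : |m| ≤ v ^ (-1 / p) * N * r ^ (β - 1) := by
      refine (aux_avg volume hu.continuousOn hr hQV hp1).trans ?_
      rw [Measure.addHaar_real_closedBall volume z hr.le, ← hvdef, hfr',
        Real.mul_rpow (by positivity) hv.le, ← Real.rpow_natCast, ← Real.rpow_mul hr.le]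
      calc _ ≤ r ^ (((n + 1 : ℕ) : ℝ) * (-1 / p)) * v ^ (-1 / p) * (r ^ (-α) * N) := by
            gcongr
        _ = v ^ (-1 / p) * N * (r ^ (((n + 1 : ℕ) : ℝ) * (-1 / p)) * r ^ (-α)) := by ring
        _ = _ := by
          rw [← Real.rpow_add hr]
          congr 2
          rw [hβ]; push_cast; ring
    have hrb : 0 < r ^ β := by positivity
    have hrb1 : 0 < r ^ (β - 1) := by positivity
    have hvp : 0 < v ^ (-1 / p) := by positivity
    constructor
    · intro a ha b hb
      have h1 := ho a ha
      have h2 := ho b hb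
      rw [abs_le] at h1 h2
      have h3 : |u a - u b| ≤ 2 * K1 * N * r ^ β := by
        rw [abs_le]; constructor <;> linarith
      refine h3.trans ?_
      gcongr
      linarith
    · intro a ha
      have h1 := ho a ha
      rw [abs_le] at h1 hav
      have h3 : |u a| ≤ K1 * N * r ^ β + v ^ (-1 / p) * N * r ^ (β - 1) := by
        rw [abs_le]; constructor <;> linarith
      have h4 : K1 * N * r ^ β ≤ K * N * r ^ β := by gcongr; linarith
      have h5 : v ^ (-1 / p) * N * r ^ (β - 1) ≤ K * N * r ^ (β - 1) := by gcongr; linarith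
      rw [mul_add]
      linarith
  have hfin := H u (K * N) (by positivity) huc hgood
  rw [← mul_assoc] at hfin
  exact hfin
end

section
/- Let U ⊂ ℝ^{n+1}_+ = {(x,y) : x ∈ ℝⁿ, y > 0} be a bounded domain with C¹ boundary such that ∂U ∩ {y = 0} is nonempty, let α ∈ (0,1), and let p satisfy 1/(1−α) < p < (n+1)/(1−α). Then for every q with 1 ≤ q < (n+1)p/(n+1−(1−α)p) there exists a constant C > 0 such that for every u ∈ C¹(closure U), ‖u‖_{L^q(U)} ≤ C·( ∫_U y^{pα}|Du|^p dxdy + ∫_U y^{pα}|u|^p dxdy )^{1/p}. -/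
open MeasureTheory
open scoped ENNReal

lemma wse_rpow_lint {h ε : ℝ} (hε : 0 < ε) :
    ∫⁻ t in Set.Ioc 0 h, ENNReal.ofReal (t ^ (ε - 1)) ≠ ⊤ := by
  rcases le_or_gt h 0 with hh | hh
  · simp [Set.Ioc_eq_empty_of_le hh]
  have h1 : IntervalIntegrable (fun t : ℝ => t ^ (ε - 1)) volume 0 h :=
    intervalIntegral.intervalIntegrable_rpow' (by linarith)
  rw [intervalIntegrable_iff_integrableOn_Ioc_of_le hh.le] at h1
  exact h1.lintegral_lt_top.ne

lemma wse_scale {E : Type*} [NormedAddCommGroup E] [NormedSpace ℝ E] [FiniteDimensional ℝ E]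
    [MeasurableSpace E] [BorelSpace E] (μ : Measure E) [μ.IsAddHaarMeasure]
    (g : E → ℝ≥0∞) (hg : Measurable g) (z : E) (t : ℝ) (ht : 0 < t) :
    ∫⁻ v, g (z + t • v) ∂μ = ENNReal.ofReal (t ^ (-(Module.finrank ℝ E : ℝ))) * ∫⁻ v, g v ∂μ := by
  have h1 : ∫⁻ v, g (z + t • v) ∂μ = ∫⁻ w, g (z + w) ∂(μ.map (t • ·)) := by
    rw [lintegral_map (by fun_prop) (by fun_prop)]
  rw [h1, Measure.map_addHaar_smul μ ht.ne', lintegral_smul_measure, lintegral_add_left_eq_self]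
  rw [abs_of_nonneg (by positivity), Real.rpow_neg ht.le, Real.rpow_natCast]
  rfl

lemma wse_A {E : Type*} [NormedAddCommGroup E] [NormedSpace ℝ E] [FiniteDimensional ℝ E]
    [MeasurableSpace E] [BorelSpace E] (μ : Measure E) [μ.IsAddHaarMeasure]
    (S : Set E) (hS : μ S ≠ ⊤) (h : ℝ) (α p q : ℝ) (hp : 1 < p) (hpq : p ≤ q)
    (hε : 0 < 1 - α - (Module.finrank ℝ E : ℝ) * (1 / p - 1 / q)) :
    ∃ C : ℝ≥0∞, C ≠ ⊤ ∧ ∀ f : E → ℝ≥0∞, Measurable f →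
      ∫⁻ z, (∫⁻ x : ℝ × E, ENNReal.ofReal (x.1 ^ (-α)) * f (z + x.1 • x.2)
        ∂((volume.restrict (Set.Ioc 0 h)).prod (μ.restrict S))) ^ q ∂μ
        ≤ C * (∫⁻ z, f z ^ p ∂μ) ^ (q / p) := by
  set ε := 1 - α - (Module.finrank ℝ E : ℝ) * (1 / p - 1 / q) with hεd
  set d : ℝ := (Module.finrank ℝ E : ℝ) with hd
  set I := ∫⁻ t in Set.Ioc 0 h, ENNReal.ofReal (t ^ (ε - 1)) with hI
  have hIt : I ≠ ⊤ := wse_rpow_lint hε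
  have hp0 : 0 < p := by linarith
  have hq0 : 0 < q := by linarith
  have hpi : 0 ≤ 1 / p - 1 / q := by
    have := one_div_le_one_div_of_le hp0 hpq; linarith
  have hp1 : 0 ≤ 1 - 1 / p := by
    have := one_div_le_one_div_of_le zero_lt_one hp.le; simp at *; linarith
  have hqp : 0 ≤ q / p - 1 := by
    rw [sub_nonneg, le_div_iff₀ hp0]; linarith
  refine ⟨(I * μ S) * I ^ (q / p - 1) * (I * μ S) ^ (q * (1 - 1 / p)), ?_, ?_⟩
  · have h1 : I * μ S ≠ ⊤ := ENNReal.mul_ne_top hIt hS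
    refine ENNReal.mul_ne_top (ENNReal.mul_ne_top h1 (ENNReal.rpow_ne_top_of_nonneg hqp hIt))
      (ENNReal.rpow_ne_top_of_nonneg (by positivity) h1)
  intro f hf
  have : IsFiniteMeasure (μ.restrict S) := ⟨by simpa using hS.lt_top⟩
  set N := ∫⁻ z, f z ^ p ∂μ with hN
  set T := (volume.restrict (Set.Ioc 0 h)).prod (μ.restrict S) with hT
  have hTpos : ∀ᵐ x ∂T, 0 < x.1 := by
    have h1 : ∀ᵐ t ∂(volume.restrict (Set.Ioc 0 h)), 0 < t := by
      filter_upwards [ae_restrict_mem measurableSet_Ioc] with t ht using ht.1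
    exact Measure.quasiMeasurePreserving_fst.ae h1
  -- third integral
  have hJ : ∫⁻ x, ENNReal.ofReal (x.1 ^ (ε - 1)) ∂T = I * μ S := by
    rw [hT, lintegral_prod _ (by fun_prop)]
    simp only [lintegral_const, Measure.restrict_apply_univ]
    rw [lintegral_mul_const _ (by fun_prop)]
  -- middle integral
  have hM : ∀ z, ∫⁻ x, ENNReal.ofReal (x.1 ^ (d - 1 + ε)) * f (z + x.1 • x.2) ^ p ∂T ≤ I * N := by
    intro z
    rw [hT, lintegral_prod _ (by fun_prop), hI, ← lintegral_mul_const _ (by fun_prop)]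
    apply setLIntegral_mono' measurableSet_Ioc
    intro t ht
    simp only
    rw [lintegral_const_mul _ (by fun_prop)]
    calc _ ≤ ENNReal.ofReal (t ^ (d - 1 + ε)) * ∫⁻ v, f (z + t • v) ^ p ∂μ := by
          gcongr; exact Measure.restrict_le_self
      _ = _ := by
          rw [wse_scale μ (fun w => f w ^ p) (by fun_prop) z t ht.1, ← mul_assoc,
            ← ENNReal.ofReal_mul (Real.rpow_nonneg ht.1.le _), ← Real.rpow_add ht.1]
          congr 3; ring
  -- Hölder
  have hH : ∀ z, (∫⁻ x, ENNReal.ofReal (x.1 ^ (-α)) * f (z + x.1 • x.2) ∂T) ^ q ≤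
      (∫⁻ x, ENNReal.ofReal (x.1 ^ (ε - 1)) * f (z + x.1 • x.2) ^ p ∂T) *
        ((I * N) ^ (q / p - 1) * (I * μ S) ^ (q * (1 - 1 / p))) := by
    intro z
    have h3 := ENNReal.lintegral_prod_norm_pow_le (μ := T) (Finset.univ : Finset (Fin 3))
      (f := ![fun x => ENNReal.ofReal (x.1 ^ (ε - 1)) * f (z + x.1 • x.2) ^ p,
        fun x => ENNReal.ofReal (x.1 ^ (d - 1 + ε)) * f (z + x.1 • x.2) ^ p,
        fun x => ENNReal.ofReal (x.1 ^ (ε - 1))]) 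
      (by
        intro i _
        fin_cases i
        · exact Measurable.aemeasurable (by simp; fun_prop)
        · exact Measurable.aemeasurable (by simp; fun_prop)
        · exact Measurable.aemeasurable (by simp; fun_prop))
      (p := ![1 / q, 1 / p - 1 / q, 1 - 1 / p])
      (by simp [Fin.sum_univ_three])
      (by
        intro i _
        fin_cases i
        · simpa using hq0.le
        · simpa using hpi
        · simpa using hp1)
    simp only [Fin.prod_univ_three, Matrix.cons_val_zero, Matrix.cons_val_one, Matrix.cons_val] at h3
    rw [hJ] at h3
    have h4 : ∫⁻ x, ENNReal.ofReal (x.1 ^ (-α)) * f (z + x.1 • x.2) ∂T ≤ 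
        (∫⁻ x, ENNReal.ofReal (x.1 ^ (ε - 1)) * f (z + x.1 • x.2) ^ p ∂T) ^ (1 / q) *
        (I * N) ^ (1 / p - 1 / q) * (I * μ S) ^ (1 - 1 / p) := by
      refine le_trans (le_of_eq ?_) (h3.trans ?_)
      · apply lintegral_congr_ae
        filter_upwards [hTpos] with x hx
        have hr : ∀ a : ℝ, 0 ≤ x.1 ^ a := fun a => Real.rpow_nonneg hx.le _
        rw [ENNReal.mul_rpow_of_nonneg _ _ (by positivity), ENNReal.mul_rpow_of_nonneg _ _ hpi,
          ENNReal.ofReal_rpow_of_nonneg (hr _) (by positivity),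
          ENNReal.ofReal_rpow_of_nonneg (hr _) hpi, ENNReal.ofReal_rpow_of_nonneg (hr _) hp1,
          ← ENNReal.rpow_mul, ← ENNReal.rpow_mul, ← Real.rpow_mul hx.le, ← Real.rpow_mul hx.le,
          ← Real.rpow_mul hx.le]
        have e1 : ∀ a b c g k: ℝ≥0∞, (a * g) * (b * k) * c = (a * b * c) * (g * k) := by
          intros; ring
        rw [e1, ← ENNReal.rpow_add_of_nonneg _ _ (by positivity) (by positivity),
          ← ENNReal.ofReal_mul (hr _), ← Real.rpow_add hx, ← ENNReal.ofReal_mul (hr _),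
          ← Real.rpow_add hx]
        have e2 : p * (1 / q) + p * (1 / p - 1 / q) = 1 := by field_simp; ring
        have e3 : (ε - 1) * (1 / q) + (d - 1 + ε) * (1 / p - 1 / q) + (ε - 1) * (1 - 1 / p) = -α := by
          rw [hεd]; ring
        rw [e2, e3, ENNReal.rpow_one]
      · gcongr
        exact hM z
    calc _ ≤ _ := ENNReal.rpow_le_rpow h4 hq0.le
      _ = _ := by
        rw [ENNReal.mul_rpow_of_nonneg _ _ hq0.le, ENNReal.mul_rpow_of_nonneg _ _ hq0.le,
          ← ENNReal.rpow_mul, ← ENNReal.rpow_mul, ← ENNReal.rpow_mul, mul_assoc]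
        have e2 : 1 / q * q = 1 := by field_simp
        have e3 : (1 / p - 1 / q) * q = q / p - 1 := by field_simp
        rw [e2, e3, ENNReal.rpow_one, mul_comm q]
  calc _ ≤ _ := lintegral_mono hH
    _ = (I * μ S * N) * ((I * N) ^ (q / p - 1) * (I * μ S) ^ (q * (1 - 1 / p))) := by
      rw [lintegral_mul_const]
      swap
      · have : Measurable (fun zx : E × (ℝ × E) => 
          ENNReal.ofReal (zx.2.1 ^ (ε - 1)) * f (zx.1 + zx.2.1 • zx.2.2) ^ p) := by fun_prop
        exact this.lintegral_prod_right'
      congr 1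
      rw [lintegral_lintegral_swap (by fun_prop)]
      rw [← hJ, ← lintegral_mul_const _ (by fun_prop)]
      apply lintegral_congr
      intro x
      rw [lintegral_const_mul _ (by fun_prop), 
        lintegral_add_right_eq_self (fun w => f w ^ p)]
    _ = _ := by
      rw [ENNReal.mul_rpow_of_nonneg _ _ hqp]
      have e1 : N ^ (q / p) = N * N ^ (q / p - 1) := by
        conv_rhs => enter [1]; rw [← ENNReal.rpow_one N]
        rw [← ENNReal.rpow_add_of_nonneg _ _ zero_le_one hqp]
        congr 1; ring
      rw [e1]; ring

lemma wse_ftc {E : Type*} [NormedAddCommGroup E] [NormedSpace ℝ E] {U : Set E} (hUo : IsOpen U)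
    (u : E → ℝ) (hu : ContDiffOn ℝ 1 u U) (z v : E) (h : ℝ) (hh : 0 < h)
    (hU : ∀ t ∈ Set.Icc 0 h, z + t • v ∈ U) :
    ‖u z‖ₑ ≤ ‖u (z + h • v)‖ₑ + ∫⁻ t in Set.Ioc 0 h, ‖v‖ₑ * ‖fderiv ℝ u (z + t • v)‖ₑ := by
  have hd : ∀ x ∈ Set.uIcc 0 h, HasDerivAt (fun t : ℝ => u (z + t • v))
      (fderiv ℝ u (z + x • v) v) x := by
    intro x hx
    rw [Set.uIcc_of_le hh.le] at hx
    have h1 : HasDerivAt (fun t : ℝ => z + t • v) v x := by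
      simpa using ((hasDerivAt_id x).smul_const v).const_add z
    have h2 : DifferentiableAt ℝ u (z + x • v) :=
      (hu.differentiableOn (by norm_num)).differentiableAt (hUo.mem_nhds (hU x hx))
    exact h2.hasFDerivAt.comp_hasDerivAt x h1
  have hc : ContinuousOn (fun t : ℝ => fderiv ℝ u (z + t • v) v) (Set.uIcc 0 h) := by
    rw [Set.uIcc_of_le hh.le]
    have h1 : ContinuousOn (fderiv ℝ u) U := hu.continuousOn_fderiv_of_isOpen hUo le_rfl
    exact (h1.comp (by fun_prop) hU).clm_apply continuousOn_const
  have h3 := intervalIntegral.integral_eq_sub_of_hasDerivAt hd hc.intervalIntegrable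
  simp only [zero_smul, add_zero] at h3
  have h4 : u z = u (z + h • v) - ∫ t in (0:ℝ)..h, fderiv ℝ u (z + t • v) v := by linarith
  rw [intervalIntegral.integral_of_le hh.le] at h4
  calc ‖u z‖ₑ = ‖u (z + h • v) - ∫ t in Set.Ioc 0 h, fderiv ℝ u (z + t • v) v‖ₑ := by rw [← h4]
    _ ≤ ‖u (z + h • v)‖ₑ + ‖∫ t in Set.Ioc 0 h, fderiv ℝ u (z + t • v) v‖ₑ := enorm_sub_le
    _ ≤ ‖u (z + h • v)‖ₑ + ∫⁻ t in Set.Ioc 0 h, ‖fderiv ℝ u (z + t • v) v‖ₑ := by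
      gcongr; exact enorm_integral_le_lintegral_enorm _
    _ ≤ _ := by
      gcongr with t
      rw [mul_comm]
      exact ContinuousLinearMap.le_opENorm _ _

lemma wse_weight {n : ℕ} {U : Set ((Fin n → ℝ) × ℝ)} {α c t : ℝ} (hα : 0 < α) (hc : 0 < c)
    (ht : 0 < t) (g : (Fin n → ℝ) × ℝ → ℝ≥0∞) (w : (Fin n → ℝ) × ℝ) (hw : w ∈ U)
    (hw2 : c * t ≤ w.2) :
    g w ≤ ENNReal.ofReal (c ^ (-α)) * (ENNReal.ofReal (t ^ (-α)) *
      U.indicator (fun w => ENNReal.ofReal (w.2 ^ α) * g w) w) := by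
  rw [Set.indicator_of_mem hw, ← mul_assoc, ← mul_assoc, ← ENNReal.ofReal_mul (by positivity),
    ← ENNReal.ofReal_mul (by positivity)]
  have h1 : 1 ≤ c ^ (-α) * t ^ (-α) * w.2 ^ α := by
    rw [← Real.mul_rpow hc.le ht.le, Real.rpow_neg (by positivity), inv_mul_eq_div,
      one_le_div (by positivity)]
    exact Real.rpow_le_rpow (by positivity) hw2 hα.le
  calc g w = 1 * g w := by rw [one_mul]
    _ ≤ _ := by
      gcongr
      rw [← ENNReal.ofReal_one]
      exact ENNReal.ofReal_le_ofReal h1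

lemma wse_B {n : ℕ} {U : Set ((Fin n → ℝ) × ℝ)} (hUo : IsOpen U)
    (z0 e : (Fin n → ℝ) × ℝ) (δ h c : ℝ) (hδ : 0 < δ) (hh : 0 < h) (hc : 0 < c)
    (hcone : ∀ z ∈ U, z ∈ Metric.ball z0 δ → ∀ v ∈ Metric.ball e δ, ∀ t ∈ Set.Icc 0 h,
        z + t • v ∈ U ∧ c * t ≤ (z + t • v).2)
    (α p q : ℝ) (hα : 0 < α) (hp : 1 < p) (hpq : p ≤ q)
    (hε : 0 < 1 - α - ((n : ℝ) + 1) * (1 / p - 1 / q)) :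
    ∃ C : ℝ≥0∞, C ≠ ⊤ ∧ ∀ u : (Fin n → ℝ) × ℝ → ℝ, ContDiffOn ℝ 1 u U →
      ∫⁻ z in U ∩ Metric.ball z0 δ, ‖u z‖ₑ ^ q ≤ 
        C * ((∫⁻ z, (U.indicator (fun w => ENNReal.ofReal (w.2 ^ α) * ‖fderiv ℝ u w‖ₑ) z) ^ p)
          + (∫⁻ z, (U.indicator (fun w => ENNReal.ofReal (w.2 ^ α) * ‖u w‖ₑ) z) ^ p)) ^ (q / p) := by
  have hHaar : (volume : Measure ((Fin n → ℝ) × ℝ)).IsAddHaarMeasure :=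
    Measure.prod.instIsAddHaarMeasure volume volume
  set S := Metric.ball e δ with hS
  have hSt : volume S ≠ ⊤ := measure_ball_lt_top.ne
  have hS0 : volume S ≠ 0 := (Metric.measure_ball_pos volume e hδ).ne'
  have hp0 : 0 < p := by linarith
  have hq0 : 0 < q := by linarith
  have hp1 : 0 ≤ 1 - 1 / p := by
    have := one_div_le_one_div_of_le zero_lt_one hp.le; simp at *; linarith
  have hfr : (Module.finrank ℝ ((Fin n → ℝ) × ℝ) : ℝ) = n + 1 := by simp
  obtain ⟨CA, hCA, HA⟩ := wse_A (volume : Measure ((Fin n → ℝ) × ℝ)) S hSt h α p q hp hpq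
    (by rw [hfr]; exact hε)
  set M := ENNReal.ofReal (‖e‖ + δ) with hM
  set K := ENNReal.ofReal (c ^ (-α)) with hK
  set H0 := ENNReal.ofReal (h ^ (-α)) with hH0
  set D := ENNReal.ofReal (h ^ (-(Module.finrank ℝ ((Fin n → ℝ) × ℝ) : ℝ))) with hD
  set A := K * H0 * (D ^ (1 / p) * (volume S) ^ (1 - 1 / p)) / volume S with hA
  set B := M * K / volume S with hB
  have hAt : A ≠ ⊤ := by
    refine ENNReal.div_ne_top (ENNReal.mul_ne_top (by finiteness) (ENNReal.mul_ne_top ?_ ?_)) hS0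
    · exact ENNReal.rpow_ne_top_of_nonneg (by positivity) (by finiteness)
    · exact ENNReal.rpow_ne_top_of_nonneg hp1 hSt
  have hBt : B ≠ ⊤ := ENNReal.div_ne_top (by finiteness) hS0
  refine ⟨2 ^ (q - 1) * (A ^ q * volume (Metric.ball z0 δ) + B ^ q * CA), ?_, ?_⟩
  · refine ENNReal.mul_ne_top (ENNReal.rpow_ne_top_of_nonneg (by linarith) (by finiteness)) ?_
    refine ENNReal.add_ne_top.2 ⟨ENNReal.mul_ne_top (ENNReal.rpow_ne_top_of_nonneg hq0.le hAt)
      measure_ball_lt_top.ne, ENNReal.mul_ne_top (ENNReal.rpow_ne_top_of_nonneg hq0.le hBt) hCA⟩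
  intro u hu
  have hmU : MeasurableSet U := hUo.measurableSet
  set f1 := U.indicator (fun w => ENNReal.ofReal (w.2 ^ α) * ‖fderiv ℝ u w‖ₑ) with hf1
  set f0 := U.indicator (fun w => ENNReal.ofReal (w.2 ^ α) * ‖u w‖ₑ) with hf0
  have hm1 : Measurable f1 := by
    have := measurable_fderiv ℝ u
    exact Measurable.indicator (by fun_prop) hmU
  have hm0 : Measurable f0 := by
    have h1 : Measurable (U.indicator u) := by
      classical
      rw [← Set.piecewise_eq_indicator]
      exact hu.continuousOn.measurable_piecewise continuousOn_const hmU
    have h2 : f0 = U.indicator (fun w => ENNReal.ofReal (w.2 ^ α) * ‖U.indicator u w‖ₑ) := by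
      ext w
      by_cases hw : w ∈ U <;> simp [hf0, hw]
    rw [h2]
    exact Measurable.indicator (by fun_prop) hmU
  set N1 := ∫⁻ z, f1 z ^ p with hN1
  set N0 := ∫⁻ z, f0 z ^ p with hN0
  set T := (volume.restrict (Set.Ioc 0 h)).prod ((volume : Measure ((Fin n → ℝ) × ℝ)).restrict S)
    with hT
  set G : (Fin n → ℝ) × ℝ → ℝ≥0∞ := fun z => ∫⁻ x : ℝ × ((Fin n → ℝ) × ℝ),
    ENNReal.ofReal (x.1 ^ (-α)) * f1 (z + x.1 • x.2) ∂T with hG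
  have hpt : ∀ z ∈ U ∩ Metric.ball z0 δ, ‖u z‖ₑ ≤ A * N0 ^ (1 / p) + B * G z := by
    rintro z ⟨hzU, hz⟩
    have h1 : ∀ v ∈ S, ‖u z‖ₑ ≤ K * H0 * f0 (z + h • v) + 
        M * K * ∫⁻ t in Set.Ioc 0 h, ENNReal.ofReal (t ^ (-α)) * f1 (z + t • v) := by
      intro v hv
      have hcv := hcone z hzU hz v hv
      refine (wse_ftc hUo u hu z v h hh (fun t ht => (hcv t ht).1)).trans ?_
      gcongr
      · have := wse_weight hα hc hh (fun w => ‖u w‖ₑ) (z + h • v) (hcv h ⟨hh.le, le_rfl⟩).1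
          (hcv h ⟨hh.le, le_rfl⟩).2
        rw [mul_assoc]
        exact this
      · rw [← lintegral_const_mul _ (by fun_prop)]
        apply setLIntegral_mono' measurableSet_Ioc
        intro t ht
        rw [mul_assoc]
        gcongr
        · rw [hM, ← ofReal_norm]
          apply ENNReal.ofReal_le_ofReal
          rw [hS, mem_ball_iff_norm] at hv
          have := norm_add_le (v - e) e
          simp only [sub_add_cancel] at this; linarith
        · exact wse_weight hα hc ht.1 (fun w => ‖fderiv ℝ u w‖ₑ) (z + t • v)
            (hcv t ⟨ht.1.le, ht.2⟩).1 (hcv t ⟨ht.1.le, ht.2⟩).2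
    have h2 : ‖u z‖ₑ * volume S ≤ K * H0 * (∫⁻ v in S, f0 (z + h • v)) + M * K * G z := by
      calc ‖u z‖ₑ * volume S = ∫⁻ v in S, ‖u z‖ₑ := by simp
        _ ≤ ∫⁻ v in S, (K * H0 * f0 (z + h • v) + 
          M * K * ∫⁻ t in Set.Ioc 0 h, ENNReal.ofReal (t ^ (-α)) * f1 (z + t • v)) :=
            setLIntegral_mono' measurableSet_ball h1
        _ = _ := by
          have hmm : Measurable (fun x : ((Fin n → ℝ) × ℝ) × ℝ => 
            ENNReal.ofReal (x.2 ^ (-α)) * f1 (z + x.2 • x.1)) := by fun_prop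
          rw [lintegral_add_left (by fun_prop), lintegral_const_mul _ (by fun_prop),
            lintegral_const_mul _ hmm.lintegral_prod_right', hG, hT]
          simp only
          rw [lintegral_prod_symm _ (by fun_prop)]
    have h3 : ∫⁻ v in S, f0 (z + h • v) ≤ (D * N0) ^ (1 / p) * volume S ^ (1 - 1 / p) := by
      have h4 := ENNReal.lintegral_mul_norm_pow_le (μ := volume.restrict S) 
        (f := fun v => f0 (z + h • v) ^ p) (g := fun _ => 1) (p := 1 / p) (q := 1 - 1 / p)
        (by fun_prop) (by fun_prop) (by positivity) hp1 (by ring)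
      simp only [ENNReal.one_rpow, mul_one, lintegral_one, Measure.restrict_apply_univ,
        ← ENNReal.rpow_mul, mul_one_div_cancel hp0.ne', ENNReal.rpow_one] at h4
      refine h4.trans ?_
      gcongr
      rw [← wse_scale volume (fun w => f0 w ^ p) (by fun_prop) z h hh]
      exact lintegral_mono' Measure.restrict_le_self le_rfl
    calc ‖u z‖ₑ = ‖u z‖ₑ * volume S / volume S := by rw [ENNReal.mul_div_cancel_right hS0 hSt]
      _ ≤ (K * H0 * ((D * N0) ^ (1 / p) * volume S ^ (1 - 1 / p)) + M * K * G z) / volume S := by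
        gcongr; refine h2.trans ?_; gcongr
      _ = _ := by
        rw [ENNReal.mul_rpow_of_nonneg _ _ (by positivity), hA, hB]
        simp only [div_eq_mul_inv]
        ring
  calc ∫⁻ z in U ∩ Metric.ball z0 δ, ‖u z‖ₑ ^ q 
      ≤ ∫⁻ z in U ∩ Metric.ball z0 δ, 2 ^ (q - 1) * (A ^ q * N0 ^ (q / p) + B ^ q * G z ^ q) := by
        apply setLIntegral_mono' (hmU.inter measurableSet_ball)
        intro z hz
        refine (ENNReal.rpow_le_rpow (hpt z hz) hq0.le).trans ?_
        refine (ENNReal.rpow_add_le_mul_rpow_add_rpow _ _ (by linarith)).trans (le_of_eq ?_)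
        rw [ENNReal.mul_rpow_of_nonneg _ _ hq0.le, ENNReal.mul_rpow_of_nonneg _ _ hq0.le,
          ← ENNReal.rpow_mul, one_div_mul_eq_div]
    _ = 2 ^ (q - 1) * (A ^ q * N0 ^ (q / p) * volume (U ∩ Metric.ball z0 δ) 
          + B ^ q * ∫⁻ z in U ∩ Metric.ball z0 δ, G z ^ q) := by
        have hGm : Measurable G := by
          have : Measurable (fun zx : ((Fin n → ℝ) × ℝ) × (ℝ × ((Fin n → ℝ) × ℝ)) => 
            ENNReal.ofReal (zx.2.1 ^ (-α)) * f1 (zx.1 + zx.2.1 • zx.2.2)) := by fun_prop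
          exact this.lintegral_prod_right'
        rw [lintegral_const_mul _ (by fun_prop), lintegral_add_left (by fun_prop),
          lintegral_const_mul (B ^ q) (by fun_prop), setLIntegral_const]
    _ ≤ 2 ^ (q - 1) * (A ^ q * (N1 + N0) ^ (q / p) * volume (Metric.ball z0 δ) 
          + B ^ q * (CA * (N1 + N0) ^ (q / p))) := by
        have hqp : 0 ≤ q / p := by positivity
        have hb : ∫⁻ z in U ∩ Metric.ball z0 δ, G z ^ q ≤ CA * (N1 + N0) ^ (q / p) := by
          refine (lintegral_mono' Measure.restrict_le_self le_rfl).trans ((HA f1 hm1).trans ?_)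
          gcongr
          exact le_self_add
        gcongr
        · exact le_add_self
        · exact Set.inter_subset_right
    _ = _ := by ring

lemma wse_cone {n : ℕ} {U : Set ((Fin n → ℝ) × ℝ)}
    (hUo : IsOpen U) 
    (hUpos : U ⊆ {p : (Fin n → ℝ) × ℝ | 0 < p.2})
    (φ : (Fin n → ℝ) × ℝ → ℝ) (hφ : ContDiff ℝ 1 φ)
    (hUφ : U = {p | φ p < 0})
    (hφgrad : ∀ p ∈ frontier U, fderiv ℝ φ p ≠ 0)
    (z0 : (Fin n → ℝ) × ℝ) (hz0 : z0 ∈ closure U) :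
    ∃ (e : (Fin n → ℝ) × ℝ) (δ h c : ℝ), 0 < δ ∧ 0 < h ∧ 0 < c ∧
      ∀ z ∈ U, z ∈ Metric.ball z0 δ → ∀ v ∈ Metric.ball e δ, ∀ t ∈ Set.Icc 0 h,
        z + t • v ∈ U ∧ c * t ≤ (z + t • v).2 := by
  have key : ∀ (e : (Fin n → ℝ) × ℝ) (r : ℝ), 0 < r → ∃ h : ℝ, 0 < h ∧ h ≤ 1 ∧ 
      ∀ z ∈ Metric.ball z0 (r/2), ∀ v ∈ Metric.ball e (r/2), ∀ t ∈ Set.Icc 0 h,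
        z + t • v ∈ Metric.ball z0 r := by
    intro e r hr
    have hpos : 0 < ‖e‖ + r/2 := by positivity
    refine ⟨min 1 (r / 2 / (‖e‖ + r/2)), by positivity, min_le_left _ _, ?_⟩
    intro z hz v hv t ht
    rw [mem_ball_iff_norm] at *
    have hv' : ‖v‖ ≤ ‖e‖ + r/2 := by
      have := norm_add_le (v - e) e
      simp at this; linarith
    have h1 : t * ‖v‖ ≤ r/2 := by
      have h2 : t ≤ r / 2 / (‖e‖ + r/2) := ht.2.trans (min_le_right _ _)
      rw [le_div_iff₀ hpos] at h2
      nlinarith [ht.1]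
    calc ‖z + t • v - z0‖ = ‖(z - z0) + t • v‖ := by congr 1; abel
      _ ≤ ‖z - z0‖ + ‖t • v‖ := norm_add_le _ _
      _ < r := by rw [norm_smul, Real.norm_of_nonneg ht.1]; linarith
  have hsnd : ∀ z ∈ U, 0 < z.2 := fun z hz => hUpos hz
  have hz0' : 0 ≤ z0.2 := by
    have : closure U ⊆ {p : (Fin n → ℝ) × ℝ | 0 ≤ p.2} :=
      closure_minimal (fun z hz => (hsnd z hz).le) (isClosed_le continuous_const continuous_snd)
    exact this hz0
  by_cases hzU : z0 ∈ U
  · have hzp := hsnd z0 hzU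
    have hev : U ∩ {p : (Fin n → ℝ) × ℝ | z0.2 / 2 < p.2} ∈ nhds z0 :=
      Filter.inter_mem (hUo.mem_nhds hzU)
        ((isOpen_lt continuous_const continuous_snd).mem_nhds (by simpa using hzp))
    obtain ⟨r, hr, hrs⟩ := Metric.mem_nhds_iff.1 hev
    obtain ⟨h, hh, hh1, H⟩ := key 0 r hr
    refine ⟨0, r/2, h, z0.2/2, by positivity, hh, by positivity, ?_⟩
    intro z _ hz v hv t ht
    have := hrs (H z hz v hv t ht)
    refine ⟨this.1, ?_⟩
    have h2 : z0.2 / 2 < (z + t • v).2 := this.2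
    nlinarith [ht.1, ht.2]
  · have hfr : z0 ∈ frontier U := by rw [hUo.frontier_eq]; exact ⟨hz0, hzU⟩
    have hg := hφgrad z0 hfr
    have hφc : Continuous φ := hφ.continuous
    have hφ0 : φ z0 ≤ 0 := by
      have : closure U ⊆ {p | φ p ≤ 0} :=
        closure_minimal (fun z hz => by rw [hUφ] at hz; exact le_of_lt (show φ z < 0 from hz))
          (isClosed_le hφc continuous_const)
      exact this hz0
    obtain ⟨e, he⟩ : ∃ e, fderiv ℝ φ z0 e < 0 := by
      by_contra! hcon
      apply hg
      refine ContinuousLinearMap.ext fun x => le_antisymm ?_ (hcon x)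
      have := hcon (-x)
      rw [map_neg] at this
      show fderiv ℝ φ z0 x ≤ 0
      linarith
    have hcont : Continuous fun wv : ((Fin n → ℝ) × ℝ) × ((Fin n → ℝ) × ℝ) =>
        fderiv ℝ φ wv.1 wv.2 := hφ.continuous_fderiv_apply (by norm_num)
    have hev : {wv : ((Fin n → ℝ) × ℝ) × ((Fin n → ℝ) × ℝ) | fderiv ℝ φ wv.1 wv.2 < 0} ∈
        nhds (z0, e) := (isOpen_lt hcont continuous_const).mem_nhds he
    obtain ⟨r, hr, hrs⟩ := Metric.mem_nhds_iff.1 hev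
    -- strict decrease, for any smaller radius
    have dec : ∀ s h : ℝ, 0 < s → s ≤ r → (∀ z ∈ Metric.ball z0 (s/2), ∀ v ∈ Metric.ball e (s/2),
        ∀ t ∈ Set.Icc 0 h, z + t • v ∈ Metric.ball z0 s) → 
        ∀ z ∈ Metric.ball z0 (s/2), ∀ v ∈ Metric.ball e (s/2),
        ∀ t ∈ Set.Ioc 0 h, φ (z + t • v) < φ z := by
      intro s h hs hsr H z hz v hv t ht
      have hd : ∀ x : ℝ, HasDerivAt (fun t : ℝ => φ (z + t • v)) (fderiv ℝ φ (z + x • v) v) x := by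
        intro x
        have h1 : HasDerivAt (fun t : ℝ => z + t • v) v x := by
          simpa using ((hasDerivAt_id x).smul_const v).const_add z
        exact ((hφ.differentiable (by norm_num)) (z + x • v)).hasFDerivAt.comp_hasDerivAt x h1
      have hanti : StrictAntiOn (fun t : ℝ => φ (z + t • v)) (Set.Icc 0 h) := by
        apply strictAntiOn_of_deriv_neg (convex_Icc 0 h)
        · exact fun x _ => (hd x).continuousAt.continuousWithinAt
        · intro x hx
          rw [interior_Icc] at hx
          rw [(hd x).deriv]
          have h3 := H z hz v hv x ⟨hx.1.le, hx.2.le⟩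
          have : (z + x • v, v) ∈ Metric.ball (z0, e) r := by
            rw [← ball_prod_same]
            exact ⟨Metric.ball_subset_ball hsr h3, Metric.ball_subset_ball (by linarith) hv⟩
          exact hrs this
      have := hanti ⟨le_rfl, ht.1.le.trans ht.2⟩ ⟨ht.1.le, ht.2⟩ ht.1
      simpa using this
    have fin : ∀ s h : ℝ, 0 < s → s ≤ r → (∀ z ∈ Metric.ball z0 (s/2), ∀ v ∈ Metric.ball e (s/2),
        ∀ t ∈ Set.Icc 0 h, z + t • v ∈ Metric.ball z0 s) → 
        ∀ z ∈ U, z ∈ Metric.ball z0 (s/2) → ∀ v ∈ Metric.ball e (s/2),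
        ∀ t ∈ Set.Icc 0 h, z + t • v ∈ U := by
      intro s h hs hsr H z hzU hz v hv t ht
      rcases ht.1.eq_or_lt with h0 | h0
      · rw [← h0]; simpa using hzU
      · have := dec s h hs hsr H z hz v hv t ⟨h0, ht.2⟩
        rw [hUφ] at hzU ⊢
        exact this.trans hzU
    rcases hz0'.eq_or_lt with hzp | hzp
    · have hepos : 0 < e.2 := by
        obtain ⟨h, hh, hh1, H⟩ := key e r hr
        have := dec r h hr le_rfl H z0 (Metric.mem_ball_self (by positivity)) e 
          (Metric.mem_ball_self (by positivity)) h ⟨hh, le_rfl⟩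
        have h4 : z0 + h • e ∈ U := by rw [hUφ]; exact this.trans_le hφ0
        have h5 := hsnd _ h4
        simp [← hzp] at h5
        exact (pos_iff_pos_of_mul_pos h5).1 hh
      have hs : 0 < min r e.2 := lt_min hr hepos
      obtain ⟨h, hh, hh1, H⟩ := key e (min r e.2) hs
      refine ⟨e, min r e.2 / 2, h, e.2/2, by positivity, hh, by positivity, ?_⟩
      intro z hzU hz v hv t ht
      refine ⟨fin _ h hs (min_le_left _ _) H z hzU hz v hv t ht, ?_⟩
      have hv2 : e.2 / 2 ≤ v.2 := by
        rw [mem_ball_iff_norm] at hv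
        have h6 := (norm_snd_le (v - e)).trans hv.le
        have h7 : min r e.2 ≤ e.2 := min_le_right _ _
        rw [Real.norm_eq_abs, abs_le] at h6
        simp at h6
        linarith [h6.1]
      have := hsnd z hzU
      simp
      nlinarith [ht.1]
    · have hev : {p : (Fin n → ℝ) × ℝ | z0.2 / 2 < p.2} ∈ nhds z0 :=
        ((isOpen_lt continuous_const continuous_snd).mem_nhds (by simpa using hzp))
      obtain ⟨r', hr', hrs'⟩ := Metric.mem_nhds_iff.1 hev
      have hs : 0 < min r r' := lt_min hr hr'
      obtain ⟨h, hh, hh1, H⟩ := key e (min r r') hs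
      refine ⟨e, min r r' / 2, h, z0.2/2, by positivity, hh, by positivity, ?_⟩
      intro z hzU hz v hv t ht
      refine ⟨fin _ h hs (min_le_left _ _) H z hzU hz v hv t ht, ?_⟩
      have h2 : z0.2 / 2 < (z + t • v).2 := 
        hrs' (Metric.ball_subset_ball (min_le_right _ _) (H z hz v hv t ht))
      nlinarith [ht.1, ht.2]

lemma wse_C {n : ℕ} {U : Set ((Fin n → ℝ) × ℝ)}
    (hUo : IsOpen U) (hUb : Bornology.IsBounded U)
    (hUpos : U ⊆ {p : (Fin n → ℝ) × ℝ | 0 < p.2})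
    (φ : (Fin n → ℝ) × ℝ → ℝ) (hφ : ContDiff ℝ 1 φ)
    (hUφ : U = {p | φ p < 0})
    (hφgrad : ∀ p ∈ frontier U, fderiv ℝ φ p ≠ 0)
    (α p q : ℝ) (hα : 0 < α) (hp : 1 < p) (hpq : p ≤ q)
    (hε : 0 < 1 - α - ((n : ℝ) + 1) * (1 / p - 1 / q)) :
    ∃ C : ℝ≥0∞, C ≠ ⊤ ∧ ∀ u : (Fin n → ℝ) × ℝ → ℝ, ContDiffOn ℝ 1 u U →
      ∫⁻ z in U, ‖u z‖ₑ ^ q ≤ 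
        C * ((∫⁻ z, (U.indicator (fun w => ENNReal.ofReal (w.2 ^ α) * ‖fderiv ℝ u w‖ₑ) z) ^ p)
          + (∫⁻ z, (U.indicator (fun w => ENNReal.ofReal (w.2 ^ α) * ‖u w‖ₑ) z) ^ p)) ^ (q / p) := by
  have hK : IsCompact (closure U) := hUb.isCompact_closure
  have := hK.induction_on (p := fun s => ∃ C : ℝ≥0∞, C ≠ ⊤ ∧ 
      ∀ u : (Fin n → ℝ) × ℝ → ℝ, ContDiffOn ℝ 1 u U → ∫⁻ z in U ∩ s, ‖u z‖ₑ ^ q ≤ 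
        C * ((∫⁻ z, (U.indicator (fun w => ENNReal.ofReal (w.2 ^ α) * ‖fderiv ℝ u w‖ₑ) z) ^ p)
          + (∫⁻ z, (U.indicator (fun w => ENNReal.ofReal (w.2 ^ α) * ‖u w‖ₑ) z) ^ p)) ^ (q / p))
    ⟨0, by simp, by simp⟩ 
    (by
      rintro s t hst ⟨C, hC, H⟩
      exact ⟨C, hC, fun u hu => (lintegral_mono_set (by gcongr)).trans (H u hu)⟩)
    (by
      rintro s t ⟨C, hC, H⟩ ⟨C', hC', H'⟩
      refine ⟨C + C', by finiteness, fun u hu => ?_⟩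
      rw [Set.inter_union_distrib_left, add_mul]
      exact (lintegral_union_le _ _ _).trans (add_le_add (H u hu) (H' u hu)))
    (by
      intro z0 hz0
      obtain ⟨e, δ, h, c, hδ, hh, hc, hcone⟩ := wse_cone hUo hUpos φ hφ hUφ hφgrad z0 hz0
      refine ⟨Metric.ball z0 δ, mem_nhdsWithin_of_mem_nhds (Metric.ball_mem_nhds z0 hδ), ?_⟩
      exact wse_B hUo z0 e δ h c hδ hh hc hcone α p q hα hp hpq hε)
  rwa [Set.inter_eq_left.2 subset_closure] at this

/-- The `L^q`-embedding case (A71) of the weighted Sobolev embedding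
`W^{1,p}_α(U) ↪ L^q(U)`, stated as the corresponding inequality for
functions of class `C¹` on a neighborhood of `closure U`. -/
theorem weighted_sobolev_embedding_Lq (n : ℕ) (U : Set ((Fin n → ℝ) × ℝ))
    (hUo : IsOpen U) (hUconn : IsConnected U) (hUb : Bornology.IsBounded U)
    (hUpos : U ⊆ {p : (Fin n → ℝ) × ℝ | 0 < p.2})
    (φ : (Fin n → ℝ) × ℝ → ℝ) (hφ : ContDiff ℝ 1 φ)
    (hUφ : U = {p | φ p < 0})
    (hφgrad : ∀ p ∈ frontier U, fderiv ℝ φ p ≠ 0)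
    (hfr : (frontier U ∩ {p : (Fin n → ℝ) × ℝ | p.2 = 0}).Nonempty)
    (α p : ℝ) (hα : α ∈ Set.Ioo (0 : ℝ) 1)
    (hp₁ : 1 / (1 - α) < p) (hp₂ : p < (n + 1) / (1 - α))
    (q : ℝ) (hq₁ : 1 ≤ q) (hq₂ : q < (n + 1) * p / (n + 1 - (1 - α) * p)) :
    ∃ C > 0, ∀ (u : (Fin n → ℝ) × ℝ → ℝ) (V : Set ((Fin n → ℝ) × ℝ)),
      IsOpen V → closure U ⊆ V → ContDiffOn ℝ 1 u V →
      (∫ z in U, |u z| ^ q) ^ (1 / q) ≤ C *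
        ((∫ z in U, z.2 ^ (p * α) * ‖fderiv ℝ u z‖ ^ p) +
          (∫ z in U, z.2 ^ (p * α) * |u z| ^ p)) ^ (1 / p) := by
  obtain ⟨hα0, hα1⟩ := hα
  have hα' : 0 < 1 - α := by linarith
  have hp : 1 < p := by
    refine lt_trans ?_ hp₁
    rw [one_lt_div hα']; linarith
  have hp0 : 0 < p := by linarith
  have hq0 : 0 < q := by linarith
  set r := max q p with hr
  have hr0 : 0 < r := lt_max_of_lt_right hp0
  have hqr : q ≤ r := le_max_left _ _
  have hD : 0 < n + 1 - (1 - α) * p := by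
    rw [lt_div_iff₀ hα'] at hp₂; linarith
  have hε : 0 < 1 - α - ((n : ℝ) + 1) * (1 / p - 1 / r) := by
    rcases max_cases q p with ⟨h1, h2⟩ | ⟨h1, h2⟩
    · rw [hr, h1]
      rw [lt_div_iff₀ hD] at hq₂
      have : 1 - α - ((n : ℝ) + 1) * (1 / p - 1 / q) =
        ((n + 1) * p - q * (n + 1 - (1 - α) * p)) / (p * q) := by field_simp; ring
      rw [this]
      apply div_pos <;> [linarith; positivity]
    · rw [hr, h1]; simpa using hα1
  obtain ⟨C, hC, H⟩ := wse_C hUo hUb hUpos φ hφ hUφ hφgrad α p r hα0 hp (le_max_right _ _) hε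
  have hmU : MeasurableSet U := hUo.measurableSet
  have hvU : volume U ≠ ⊤ := hUb.measure_lt_top.ne
  have hqr1 : 0 ≤ 1 - q / r := by rw [sub_nonneg, div_le_one hr0]; exact hqr
  set C' := (C ^ (q / r) * volume U ^ (1 - q / r)) ^ (1 / q) with hC'
  have hC't : C' ≠ ⊤ := ENNReal.rpow_ne_top_of_nonneg (by positivity)
    (ENNReal.mul_ne_top (ENNReal.rpow_ne_top_of_nonneg (by positivity) hC)
      (ENNReal.rpow_ne_top_of_nonneg hqr1 hvU))
  refine ⟨C'.toReal + 1, by positivity, ?_⟩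
  intro u V hV hUV hu
  have huU : ContDiffOn ℝ 1 u U := hu.mono (subset_closure.trans hUV)
  have hK : IsCompact (closure U) := hUb.isCompact_closure
  have hint : ∀ g : (Fin n → ℝ) × ℝ → ℝ, ContinuousOn g (closure U) → IntegrableOn g U := 
    fun g hg => (hg.integrableOn_compact hK).mono_set subset_closure
  have hcu : ContinuousOn u (closure U) := hu.continuousOn.mono hUV
  have hcd : ContinuousOn (fderiv ℝ u) (closure U) :=
    (hu.continuousOn_fderiv_of_isOpen hV le_rfl).mono hUV
  have hpα : 0 < p * α := by positivity
  have hcw : Continuous (fun z : (Fin n → ℝ) × ℝ => z.2 ^ (p * α)) :=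
    continuous_snd.rpow_const (fun _ => Or.inr hpα.le)
  have hy : ∀ z ∈ U, 0 < z.2 := fun z hz => hUpos hz
  have hgen : ∀ (g : (Fin n → ℝ) × ℝ → ℝ), (∀ z, 0 ≤ g z) → ContinuousOn g (closure U) →
      0 ≤ (∫ z in U, z.2 ^ (p * α) * g z ^ p) ∧
      ENNReal.ofReal (∫ z in U, z.2 ^ (p * α) * g z ^ p) =
      ∫⁻ z, (U.indicator (fun w => ENNReal.ofReal (w.2 ^ α) * ENNReal.ofReal (g w)) z) ^ p := by
    intro g hg0 hg
    have hnn : ∀ z ∈ U, 0 ≤ z.2 ^ (p * α) * g z ^ p := fun z hz =>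
      mul_nonneg (Real.rpow_nonneg (hy z hz).le _) (Real.rpow_nonneg (hg0 z) _)
    refine ⟨setIntegral_nonneg hmU hnn, ?_⟩
    rw [ofReal_integral_eq_lintegral_ofReal (hint (fun z => z.2 ^ (p * α) * g z ^ p)
      (hcw.continuousOn.mul (hg.rpow_const (fun _ _ => Or.inr hp0.le))))
      ((ae_restrict_mem hmU).mono hnn), ← lintegral_indicator hmU]
    apply lintegral_congr
    intro z
    by_cases hz : z ∈ U
    · simp only [Set.indicator_of_mem hz]
      have hz2 := (hy z hz).le
      rw [← ENNReal.ofReal_mul (by positivity), ENNReal.ofReal_rpow_of_nonneg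
        (mul_nonneg (by positivity) (hg0 z)) hp0.le, Real.mul_rpow (by positivity) (hg0 z),
        ← Real.rpow_mul hz2, mul_comm α p]
    · simp [Set.indicator_of_notMem hz, hp0]
  obtain ⟨h1nn, h1⟩ := hgen (fun z => ‖fderiv ℝ u z‖) (fun _ => norm_nonneg _) hcd.norm
  obtain ⟨h0nn, h0⟩ := hgen (fun z => |u z|) (fun _ => abs_nonneg _) hcu.abs
  have hHu := H u huU
  simp only [← Real.norm_eq_abs, ofReal_norm] at h1 h0 h0nn h1nn ⊢
  rw [← h1, ← h0, ← ENNReal.ofReal_add h1nn h0nn] at hHu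
  set R := (∫ z in U, z.2 ^ (p * α) * ‖fderiv ℝ u z‖ ^ p) + 
    (∫ z in U, z.2 ^ (p * α) * ‖u z‖ ^ p) with hR
  have hR0 : 0 ≤ R := add_nonneg h1nn h0nn
  have hL0 : 0 ≤ ∫ z in U, ‖u z‖ ^ q := integral_nonneg (fun z => by positivity)
  have hL : ENNReal.ofReal (∫ z in U, ‖u z‖ ^ q) = ∫⁻ z in U, ‖u z‖ₑ ^ q := by
    rw [ofReal_integral_eq_lintegral_ofReal
      (hint _ (hcu.norm.rpow_const (fun _ _ => Or.inr hq0.le)))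
      (Filter.Eventually.of_forall (fun z => by positivity))]
    apply lintegral_congr
    intro z
    rw [← ofReal_norm, ENNReal.ofReal_rpow_of_nonneg (norm_nonneg _) hq0.le]
  have hum : AEMeasurable u (volume.restrict U) := huU.continuousOn.aemeasurable hmU
  have hX : ∫⁻ z in U, ‖u z‖ₑ ^ q ≤ (∫⁻ z in U, ‖u z‖ₑ ^ r) ^ (q / r) * volume U ^ (1 - q / r) := by
    have h4 := ENNReal.lintegral_mul_norm_pow_le (μ := volume.restrict U) 
      (f := fun v => ‖u v‖ₑ ^ r) (g := fun _ => 1) (p := q / r) (q := 1 - q / r)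
      (by fun_prop) (by fun_prop) (by positivity) hqr1 (by ring)
    simpa only [ENNReal.one_rpow, mul_one, lintegral_one, Measure.restrict_apply_univ,
      ← ENNReal.rpow_mul, mul_div_cancel₀ q hr0.ne'] using h4
  have hfin : ENNReal.ofReal ((∫ z in U, ‖u z‖ ^ q) ^ (1 / q)) ≤
      ENNReal.ofReal (C'.toReal * R ^ (1 / p)) := by
    rw [← ENNReal.ofReal_rpow_of_nonneg hL0 (by positivity), hL,
      ENNReal.ofReal_mul ENNReal.toReal_nonneg, ENNReal.ofReal_toReal hC't,
      ← ENNReal.ofReal_rpow_of_nonneg hR0 (by positivity)]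
    calc (∫⁻ z in U, ‖u z‖ₑ ^ q) ^ (1 / q) 
        ≤ ((C * ENNReal.ofReal R ^ (r / p)) ^ (q / r) * volume U ^ (1 - q / r)) ^ (1 / q) := by
          apply ENNReal.rpow_le_rpow _ (by positivity)
          refine hX.trans ?_
          gcongr
      _ = _ := by
          rw [ENNReal.mul_rpow_of_nonneg C _ (by positivity), mul_right_comm, hC',
            ENNReal.mul_rpow_of_nonneg _ _ (by positivity), ← ENNReal.rpow_mul, ← ENNReal.rpow_mul]
          congr 2
          field_simp
  have hRp : 0 ≤ R ^ (1 / p) := Real.rpow_nonneg hR0 _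
  have := (ENNReal.ofReal_le_ofReal_iff (mul_nonneg ENNReal.toReal_nonneg hRp)).1 hfin
  nlinarith
end
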